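/- arXiv:1912.05739 — 2 statements merged into one kernel-verified Lean document; each statement's English description precedes it below -/
import Mathlib

section
/- Let k_1 ∈ [0,N]. A zero-mean nonsingular Gaussian sequence [x_k], k ∈ [0,N], is both CM_L and [k_1,N]-CM_F if and only if it obeys a CM_L model whose parameters satisfy G_k⁻¹ G_{k,N} = G_{k+1,k}' G_{k+1}⁻¹ G_{k+1,N} for all k ∈ [k_1+1, N−2]. -/
open MeasureTheory ProbabilityTheory Matrix
open scoped NNReal

namespace CMSeqPaper

variable {Ω : Type*} [MeasurableSpace Ω]

/-- Square `d × d` real matrices. -/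
abbrev Mat (d : ℕ) := Matrix (Fin d) (Fin d) ℝ

/-- `X` is a zero-mean jointly Gaussian random vector with covariance matrix `C`
(Cramér–Wold characterization: every linear functional of `X` is a centered real
Gaussian with the induced variance). -/
def IsZeroMeanGaussian {ι : Type*} [Fintype ι] (μ : Measure Ω)
    (X : Ω → ι → ℝ) (C : Matrix ι ι ℝ) : Prop :=
  ∀ l : ι → ℝ,
    μ.map (fun ω => ∑ i, l i * X ω i) = gaussianReal 0 (l ⬝ᵥ C.mulVec l).toNNReal

/-- The stacked vector over times `0, …, N` of a `d`-dimensional sequence. -/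
def stack (N d : ℕ) (x : ℕ → Ω → Fin d → ℝ) : Ω → Fin (N + 1) × Fin d → ℝ :=
  fun ω p => x (p.1 : ℕ) ω p.2

/-- `[x_k]`, `k ∈ [0,N]`, is a zero-mean nonsingular Gaussian sequence whose stacked
vector has (positive definite) covariance matrix `C`. -/
def ZMNG (N d : ℕ) (μ : Measure Ω) (x : ℕ → Ω → Fin d → ℝ)
    (C : Matrix (Fin (N + 1) × Fin d) (Fin (N + 1) × Fin d) ℝ) : Prop :=
  (∀ k, k ≤ N → Measurable (x k)) ∧
    IsZeroMeanGaussian μ (stack N d x) C ∧ C.PosDef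

/-- The σ-algebra generated by the states at the times in `S`. -/
def sigmaOf {d : ℕ} (x : ℕ → Ω → Fin d → ℝ) (S : Set ℕ) : MeasurableSpace Ω :=
  ⨆ i ∈ S, MeasurableSpace.comap (x i) inferInstance

/-- The conditional distribution of `x k` given the states at the times in `S`
coincides (a.e.) with the conditional distribution of `x k` given the states at the
times in `T`. -/
def CondEq {d : ℕ} (μ : Measure Ω) (x : ℕ → Ω → Fin d → ℝ) (k : ℕ)
    (S T : Set ℕ) : Prop :=
  ∀ A : Set (Fin d → ℝ), MeasurableSet A →
    μ[A.indicator (fun _ => (1 : ℝ)) ∘ x k | sigmaOf x S]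
      =ᵐ[μ] μ[A.indicator (fun _ => (1 : ℝ)) ∘ x k | sigmaOf x T]

/-- `[x_k]` is `[k₁,k₂]`-CM_c: for all `k₁ ≤ j < k ≤ k₂`, the conditional
distribution of `x k` given `(x_{k₁}, …, x_j, x_c)` equals the one given `(x_j, x_c)`. -/
def IsCM {d : ℕ} (μ : Measure Ω) (x : ℕ → Ω → Fin d → ℝ) (k₁ k₂ c : ℕ) : Prop :=
  ∀ j k, k₁ ≤ j → j < k → k ≤ k₂ →
    CondEq μ x k (Set.Icc k₁ j ∪ {c}) ({j} ∪ {c})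

/-- `[x_k]` is Markov on the index interval `[a,b]`. -/
def IsMarkovOn {d : ℕ} (μ : Measure Ω) (x : ℕ → Ω → Fin d → ℝ) (a b : ℕ) : Prop :=
  ∀ j k, a ≤ j → j < k → k ≤ b → CondEq μ x k (Set.Icc a j) {j}

/-- `[x_k]` is reciprocal on `[0,N]`. -/
def IsReciprocal {d : ℕ} (μ : Measure Ω) (x : ℕ → Ω → Fin d → ℝ) (N : ℕ) : Prop :=
  ∀ j k l, j < k → k < l → l ≤ N →
    CondEq μ x k (Set.Icc 0 j ∪ Set.Icc l N) ({j} ∪ {l})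

/-- Block `(i,j)` of the block matrix `A` is zero. -/
def BlockZero {n d : ℕ} (A : Matrix (Fin n × Fin d) (Fin n × Fin d) ℝ)
    (i j : Fin n) : Prop :=
  ∀ a b, A (i, a) (j, b) = 0

/-- `|i - j| ≥ 2` for block indices. -/
def Far {n : ℕ} (i j : Fin n) : Prop :=
  (i : ℕ) + 2 ≤ (j : ℕ) ∨ (j : ℕ) + 2 ≤ (i : ℕ)

/-- Block tri-diagonal: every block `(i,j)` with `|i-j| ≥ 2` is zero. -/
def BlockTriDiag {n d : ℕ} (A : Matrix (Fin n × Fin d) (Fin n × Fin d) ℝ) : Prop :=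
  ∀ i j, Far i j → BlockZero A i j

/-- The CM_L form: every block `(i,j)` with `|i-j| ≥ 2` is zero except possibly
blocks in the last block row and last block column. -/
def HasCMLForm {n d : ℕ} (A : Matrix (Fin n × Fin d) (Fin n × Fin d) ℝ) : Prop :=
  ∀ i j, Far i j → (i : ℕ) ≠ n - 1 → (j : ℕ) ≠ n - 1 → BlockZero A i j

/-- The CM_F form: every block `(i,j)` with `|i-j| ≥ 2` is zero except possibly
blocks in the first block row and first block column. -/
def HasCMFForm {n d : ℕ} (A : Matrix (Fin n × Fin d) (Fin n × Fin d) ℝ) : Prop :=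
  ∀ i j, Far i j → (i : ℕ) ≠ 0 → (j : ℕ) ≠ 0 → BlockZero A i j

/-- Cyclic block tri-diagonal: every block `(i,j)` with `|i-j| ≥ 2` is zero except
possibly the corner blocks `(0, n-1)` and `(n-1, 0)`. -/
def CyclicBlockTriDiag {n d : ℕ} (A : Matrix (Fin n × Fin d) (Fin n × Fin d) ℝ) : Prop :=
  ∀ i j, Far i j → ¬((i : ℕ) = 0 ∧ (j : ℕ) = n - 1) →
    ¬((i : ℕ) = n - 1 ∧ (j : ℕ) = 0) → BlockZero A i j

/-- The stacked block-diagonal matrix with diagonal blocks `G 0, …, G N`. -/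
def blockDiag (N d : ℕ) (G : ℕ → Mat d) :
    Matrix (Fin (N + 1) × Fin d) (Fin (N + 1) × Fin d) ℝ :=
  fun p q => if (p.1 : ℕ) = (q.1 : ℕ) then G (p.1 : ℕ) p.2 q.2 else 0

/-- `[x_k]` obeys the CM_L model with parameters `Gm k = G_{k,k-1}` and
`GN k = G_{k,N}` for `k ∈ [1,N-1]`, boundary parameter `GN 0 = G_{0,N}`, and noise
covariances `Gcov k = G_k = Cov(e_k)`: the `e_k` are zero-mean jointly Gaussian,
mutually uncorrelated, with positive definite covariances, with
`x_k = G_{k,k-1} x_{k-1} + G_{k,N} x_N + e_k` for `k ∈ [1,N-1]`, and boundary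
condition `x_N = e_N`, `x_0 = G_{0,N} x_N + e_0`. -/
def CMLModel (N d : ℕ) (μ : Measure Ω) (x : ℕ → Ω → Fin d → ℝ)
    (Gm GN Gcov : ℕ → Mat d) : Prop :=
  ∃ e : ℕ → Ω → Fin d → ℝ,
    ZMNG N d μ e (blockDiag N d Gcov) ∧
    (∀ k, k ≤ N → (Gcov k).PosDef) ∧
    (∀ᵐ ω ∂μ,
      (∀ k, 1 ≤ k → k ≤ N - 1 →
        x k ω = (Gm k).mulVec (x (k - 1) ω) + (GN k).mulVec (x N ω) + e k ω) ∧
      x N ω = e N ω ∧ x 0 ω = (GN 0).mulVec (x N ω) + e 0 ω)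

/-- `[y_k]` obeys the Markov model with parameters `Mm k = M_{k,k-1}` for
`k ∈ [1,N]` and noise covariances `Mcov k = M_k = Cov(e_k)`: the `e_k` are
zero-mean jointly Gaussian, mutually uncorrelated, with positive definite
covariances, `y_0 = e_0` and `y_k = M_{k,k-1} y_{k-1} + e_k` for `k ∈ [1,N]`. -/
def MarkovModel (N d : ℕ) (μ : Measure Ω) (y : ℕ → Ω → Fin d → ℝ)
    (Mm Mcov : ℕ → Mat d) : Prop :=
  ∃ e : ℕ → Ω → Fin d → ℝ,
    ZMNG N d μ e (blockDiag N d Mcov) ∧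
    (∀ k, k ≤ N → (Mcov k).PosDef) ∧
    (∀ᵐ ω ∂μ, y 0 ω = e 0 ω ∧
      ∀ k, 1 ≤ k → k ≤ N → y k ω = (Mm k).mulVec (y (k - 1) ω) + e k ω)

/-- Representation of `[x_k]` as a zero-mean nonsingular Gaussian Markov sequence
plus `Γ_k x_c`, where `c ∈ {0,N}`: `y` (which coincides with `x` at time `c`) is
jointly zero-mean nonsingular Gaussian, the states of `y` at times `≠ c` are
uncorrelated with `y c = x c`, `y` is Markov on `[0,N] \ {c}`, and
`x_k = y_k + Γ_k x_c` for `k ∈ [0,N] \ {c}`. -/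
def MarkovPlusVector (N d c : ℕ) (μ : Measure Ω) (x y : ℕ → Ω → Fin d → ℝ)
    (Γ : ℕ → Mat d) : Prop :=
  ∃ C' : Matrix (Fin (N + 1) × Fin d) (Fin (N + 1) × Fin d) ℝ,
    (∀ᵐ ω ∂μ, y c ω = x c ω) ∧
    ZMNG N d μ y C' ∧
    (∀ i j : Fin (N + 1),
      (((i : ℕ) = c ∧ (j : ℕ) ≠ c) ∨ ((i : ℕ) ≠ c ∧ (j : ℕ) = c)) →
      ∀ a b, C' (i, a) (j, b) = 0) ∧
    IsMarkovOn μ y (if c = 0 then 1 else 0) (if c = 0 then N else N - 1) ∧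
    (∀ᵐ ω ∂μ, ∀ k, k ≤ N → k ≠ c → x k ω = y k ω + (Γ k).mulVec (x c ω))

/-- `M_{N|k} = M_{N,N-1} ⋯ M_{k+1,k}` (with `M_{N|N} = I`), where `Mm k = M_{k,k-1}`. -/
def MNk (d : ℕ) (Mm : ℕ → Mat d) (N k : ℕ) : Mat d :=
  (List.range (N - k)).foldl (fun A i => A * Mm (N - i)) 1

/-- `C_{N|k} = ∑_{n=k}^{N-1} M_{N|n+1} M_{n+1} M_{N|n+1}'`. -/
def CNk (d : ℕ) (Mm Mcov : ℕ → Mat d) (N k : ℕ) : Mat d :=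
  ∑ n ∈ Finset.Icc k (N - 1), MNk d Mm N (n + 1) * Mcov (n + 1) * (MNk d Mm N (n + 1))ᵀ

/-- The `(N+1)d × (N+1)d` matrix `[[B₁, 0], [0, 0]]` (`B₁` occupies the first `N`
block rows and columns). -/
def embedL (N d : ℕ) (B₁ : Matrix (Fin N × Fin d) (Fin N × Fin d) ℝ) :
    Matrix (Fin (N + 1) × Fin d) (Fin (N + 1) × Fin d) ℝ :=
  fun p q =>
    if h : (p.1 : ℕ) < N ∧ (q.1 : ℕ) < N then
      B₁ (⟨(p.1 : ℕ), h.1⟩, p.2) (⟨(q.1 : ℕ), h.2⟩, q.2)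
    else 0

/-- The `(N+1)d × d` matrix `Γ = [S; I]`. -/
def gammaL (N d : ℕ) (S : Matrix (Fin N × Fin d) (Fin d) ℝ) :
    Matrix (Fin (N + 1) × Fin d) (Fin d) ℝ :=
  fun p a =>
    if h : (p.1 : ℕ) < N then S (⟨(p.1 : ℕ), h⟩, p.2) a
    else (1 : Mat d) p.2 a

/-- The `(N+1)d × (N+1)d` matrix `[[0, 0], [0, B₂]]` (`B₂` occupies the last `N`
block rows and columns). -/
def embedF (N d : ℕ) (B₂ : Matrix (Fin N × Fin d) (Fin N × Fin d) ℝ) :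
    Matrix (Fin (N + 1) × Fin d) (Fin (N + 1) × Fin d) ℝ :=
  fun p q =>
    if h : 0 < (p.1 : ℕ) ∧ 0 < (q.1 : ℕ) then
      B₂ (⟨(p.1 : ℕ) - 1, by have := p.1.isLt; omega⟩, p.2)
        (⟨(q.1 : ℕ) - 1, by have := q.1.isLt; omega⟩, q.2)
    else 0

/-- The `(N+1)d × d` matrix `Γ = [I; S]`. -/
def gammaF (N d : ℕ) (S : Matrix (Fin N × Fin d) (Fin d) ℝ) :
    Matrix (Fin (N + 1) × Fin d) (Fin d) ℝ :=
  fun p a =>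
    if h : 0 < (p.1 : ℕ) then
      S (⟨(p.1 : ℕ) - 1, by have := p.1.isLt; omega⟩, p.2) a
    else (1 : Mat d) p.2 a

section Gauss

variable {ι : Type*} [Fintype ι] {μ : Measure Ω} {z : Ω → ι → ℝ} {C : Matrix ι ι ℝ}

/-- The linear functional of `z` with coefficient vector `u`. -/
def Lf (z : Ω → ι → ℝ) (u : ι → ℝ) : Ω → ℝ := fun ω => ∑ i, u i * z ω i

lemma Lf_measurable (hz : Measurable z) (u : ι → ℝ) : Measurable (Lf z u) := by
  unfold Lf
  fun_prop

lemma Lf_add (u v : ι → ℝ) : Lf z (u + v) = Lf z u + Lf z v := by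
  ext ω
  simp [Lf, add_mul, Finset.sum_add_distrib]

lemma Lf_sub (u v : ι → ℝ) : Lf z (u - v) = Lf z u - Lf z v := by
  ext ω
  simp [Lf, sub_mul, Finset.sum_sub_distrib]

lemma gauss_law (hz : Measurable z) (hG : IsZeroMeanGaussian μ z C) :
    HasGaussianLaw z μ := by
  classical
  refine ⟨isGaussian_of_map_eq_gaussianReal fun L => ?_⟩
  refine ⟨0, ((fun i => L (Pi.single i 1)) ⬝ᵥ C.mulVec (fun i => L (Pi.single i 1))).toNNReal, ?_⟩
  · rw [Measure.map_map (by fun_prop) hz]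
    have : (L ∘ z) = fun ω => ∑ i, (L (Pi.single i 1)) * z ω i := by
      ext ω
      have h : z ω = ∑ i, z ω i • (Pi.single i (1 : ℝ) : ι → ℝ) := by
        ext j
        simp [Finset.sum_apply, Pi.single_apply]
      conv_lhs => rw [Function.comp_apply, h]
      simp [map_sum, mul_comm]
    rw [this]
    exact hG _

lemma Lf_memLp (hz : Measurable z) (hG : IsZeroMeanGaussian μ z C) (u : ι → ℝ) :
    MemLp (Lf z u) 2 μ := by
  have h : MemLp (id : ℝ → ℝ) 2 (μ.map (Lf z u)) := by
    have := hG u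
    unfold Lf
    rw [this]
    exact memLp_id_gaussianReal 2
  exact (memLp_map_measure_iff (by fun_prop) (Lf_measurable hz u).aemeasurable).1 h

lemma Lf_mean (hz : Measurable z) (hG : IsZeroMeanGaussian μ z C) (u : ι → ℝ) :
    ∫ ω, Lf z u ω ∂μ = 0 := by
  have h : ∫ y, y ∂(μ.map (Lf z u)) = 0 := by
    have := hG u
    unfold Lf
    rw [this]
    exact integral_id_gaussianReal
  rwa [integral_map (Lf_measurable hz u).aemeasurable (by fun_prop)] at h

lemma Lf_var (hz : Measurable z) (hG : IsZeroMeanGaussian μ z C) (hC : C.PosSemidef)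
    (u : ι → ℝ) : Var[Lf z u; μ] = u ⬝ᵥ C *ᵥ u := by
  have h : Var[id; μ.map (Lf z u)] = (u ⬝ᵥ C *ᵥ u) := by
    have := hG u
    unfold Lf
    rw [this]
    rw [variance_id_gaussianReal]
    have := hC.dotProduct_mulVec_nonneg u
    simp at this
    simp [this]
  rwa [variance_map (by fun_prop) (Lf_measurable hz u).aemeasurable] at h

lemma quad_symm (hC : C.PosSemidef) (u v : ι → ℝ) : v ⬝ᵥ C *ᵥ u = u ⬝ᵥ C *ᵥ v := by
  have h : Cᵀ = C := by simpa using hC.isHermitian.eq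
  conv_lhs => rw [← h]
  rw [Matrix.mulVec_transpose, dotProduct_comm, Matrix.dotProduct_mulVec]

lemma Lf_cov [IsProbabilityMeasure μ] (hz : Measurable z) (hG : IsZeroMeanGaussian μ z C)
    (hC : C.PosSemidef) (u v : ι → ℝ) : cov[Lf z u, Lf z v; μ] = u ⬝ᵥ C *ᵥ v := by
  have h := variance_add (Lf_memLp hz hG u) (Lf_memLp hz hG v)
  rw [← Lf_add, Lf_var hz hG hC, Lf_var hz hG hC, Lf_var hz hG hC] at h
  simp only [add_dotProduct, dotProduct_add, Matrix.mulVec_add] at h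
  rw [quad_symm hC u v] at h
  linarith

lemma indep_of_cov [IsProbabilityMeasure μ] {α β : Type*} [Fintype α] [Fintype β]
    (hz : Measurable z) (hG : IsZeroMeanGaussian μ z C)
    (hC : C.PosSemidef) (R : Matrix α ι ℝ) (Q : Matrix β ι ℝ) (h : R * C * Qᵀ = 0) :
    IndepFun (fun ω => R *ᵥ z ω) (fun ω => Q *ᵥ z ω) μ := by
  have hl := gauss_law hz hG
  let f : (ι → ℝ) →L[ℝ] ((α → ℝ) × (β → ℝ)) :=
    LinearMap.toContinuousLinearMap (R.mulVecLin.prod Q.mulVecLin)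
  have h2 : HasGaussianLaw (fun ω => f (z ω)) μ := hl.map_fun f
  refine HasGaussianLaw.indepFun_of_covariance_eval (X := fun i => Lf z (R i))
    (Y := fun j => Lf z (Q j)) h2 ?_
  intro i j
  rw [Lf_cov hz hG hC]
  have := congrFun (congrFun h i) j
  rw [Matrix.mul_assoc] at this
  simpa [Matrix.mul_apply, dotProduct, mulVec] using this

lemma freeze [IsProbabilityMeasure μ] {α β : Type*} [mα : MeasurableSpace α]
    [mβ : MeasurableSpace β]
    {Z : Ω → α} {R : Ω → β} (hZ : Measurable Z) (hR : Measurable R) (hI : IndepFun Z R μ)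
    (D : Set (α × β)) (hD : MeasurableSet D) :
    (fun ω => ∫ r, D.indicator (fun _ => (1 : ℝ)) (Z ω, r) ∂(μ.map R)) =ᵐ[μ]
      μ[fun ω => D.indicator (fun _ => (1 : ℝ)) (Z ω, R ω) | MeasurableSpace.comap Z mα] := by
  have := Measure.isProbabilityMeasure_map (μ := μ) hR.aemeasurable
  have := Measure.isProbabilityMeasure_map (μ := μ) hZ.aemeasurable
  have hm : Measurable (D.indicator (fun _ => (1 : ℝ))) := measurable_const.indicator hD
  have hF : StronglyMeasurable (fun y => ∫ r, D.indicator (fun _ => (1 : ℝ)) (y, r) ∂(μ.map R)) :=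
    StronglyMeasurable.integral_prod_right' (f := D.indicator (fun _ => (1 : ℝ)))
      hm.stronglyMeasurable
  have hb : ∀ y, ‖D.indicator (fun _ => (1 : ℝ)) y‖ ≤ 1 := by
    intro y
    by_cases h : y ∈ D <;> simp [h]
  have hFb : ∀ y, ‖∫ r, D.indicator (fun _ => (1 : ℝ)) (y, r) ∂(μ.map R)‖ ≤ 1 := by
    intro y
    refine (norm_integral_le_of_norm_le_const (C := 1) (Filter.Eventually.of_forall fun r => hb _)).trans ?_
    simp
  refine ae_eq_condExp_of_forall_setIntegral_eq hZ.comap_le ?_ ?_ ?_ ?_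
  · refine Integrable.of_bound (C := 1) (hm.comp (hZ.prodMk hR)).aestronglyMeasurable (Filter.Eventually.of_forall fun ω => hb _)
  · intro s _ _
    refine Integrable.integrableOn (Integrable.of_bound (C := 1) ?_ (Filter.Eventually.of_forall fun ω => hFb _))
    exact (hF.measurable.comp hZ).aestronglyMeasurable
  · rintro s ⟨B, hB, rfl⟩ _
    have hmap := (indepFun_iff_map_prod_eq_prod_map_map hZ.aemeasurable hR.aemeasurable).1 hI
    have e1 : ∫ ω in Z ⁻¹' B, D.indicator (fun _ => (1 : ℝ)) (Z ω, R ω) ∂μ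
        = ∫ p in B ×ˢ Set.univ, D.indicator (fun _ => (1 : ℝ)) p ∂((μ.map Z).prod (μ.map R)) := by
      rw [← hmap, setIntegral_map (hB.prod MeasurableSet.univ) (by fun_prop) (by fun_prop)]
      congr 2
      ext ω
      simp
    have e2 : ∫ ω in Z ⁻¹' B, (∫ r, D.indicator (fun _ => (1 : ℝ)) (Z ω, r) ∂(μ.map R)) ∂μ
        = ∫ y in B, (∫ r, D.indicator (fun _ => (1 : ℝ)) (y, r) ∂(μ.map R)) ∂(μ.map Z) := by
      rw [setIntegral_map hB hF.aestronglyMeasurable hZ.aemeasurable]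
    rw [e1, e2, setIntegral_prod]
    · simp
    · exact (Integrable.of_bound (C := 1) hm.aestronglyMeasurable (Filter.Eventually.of_forall fun ω => hb _)).integrableOn
  · exact (hF.comp_measurable (comap_measurable Z)).aestronglyMeasurable

lemma condExp_comp_aux {Ω' α : Type*} [MeasurableSpace α] {m m0 : MeasurableSpace Ω'}
    {ν : Measure Ω'} [IsProbabilityMeasure ν] (hm : m ≤ m0)
    {X : Ω' → α} (_hX : Measurable X) (hmp : MeasurePreserving X ν (ν.map X))
    (f : α →₁[ν.map X] ℝ) :
    ν[f ∘ X | m] =ᵐ[ν] condExpL1CLM ℝ hm ν (Lp.compMeasurePreserving X hmp f) := by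
  have h1 : ν[f ∘ X | m] =ᵐ[ν] ν[(Lp.compMeasurePreserving X hmp f : Ω' → ℝ) | m] :=
    condExp_congr_ae (Lp.coeFn_compMeasurePreserving f hmp).symm
  refine h1.trans ((condExp_ae_eq_condExpL1CLM hm (L1.integrable_coeFn _)).trans ?_)
  rw [Integrable.toL1_coeFn]

lemma condExp_transfer {Ω' α : Type*} [MeasurableSpace α] {m₁ m₂ m0 : MeasurableSpace Ω'}
    {ν : Measure Ω'} [IsProbabilityMeasure ν] (hm₁ : m₁ ≤ m0) (hm₂ : m₂ ≤ m0)
    {X : Ω' → α} (hX : Measurable X)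
    (h : ∀ A : Set α, MeasurableSet A →
      ν[A.indicator (fun _ => (1 : ℝ)) ∘ X | m₁] =ᵐ[ν] ν[A.indicator (fun _ => (1 : ℝ)) ∘ X | m₂])
    {f : α → ℝ} (hf : Integrable f (ν.map X)) : ν[f ∘ X | m₁] =ᵐ[ν] ν[f ∘ X | m₂] := by
  have hmp : MeasurePreserving X ν (ν.map X) := hX.measurePreserving ν
  refine Integrable.induction (μ := ν.map X)
    (fun f : α → ℝ => ν[f ∘ X | m₁] =ᵐ[ν] ν[f ∘ X | m₂]) ?_ ?_ ?_ ?_ hf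
  · intro c s hs _
    have : (s.indicator fun _ => c) ∘ X = c • (s.indicator (fun _ => (1 : ℝ)) ∘ X) := by
      ext ω
      by_cases h : X ω ∈ s <;> simp [h]
    rw [this]
    exact (condExp_smul c _ _).trans (((h s hs).const_smul c).trans (condExp_smul c _ _).symm)
  · intro f g _ hf hg hf' hg'
    have h1 := hmp.integrable_comp_of_integrable hf
    have h2 := hmp.integrable_comp_of_integrable hg
    exact (condExp_add h1 h2 m₁).trans ((hf'.add hg').trans (condExp_add h1 h2 m₂).symm)
  · have hQ : Continuous (Lp.compMeasurePreserving (E := ℝ) (p := 1) X hmp) :=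
      (Lp.isometry_compMeasurePreserving hmp).continuous
    have key := fun f => condExp_comp_aux (m := m₁) hm₁ hX hmp f
    have key' := fun f => condExp_comp_aux (m := m₂) hm₂ hX hmp f
    have : {f : α →₁[ν.map X] ℝ | ν[f ∘ X | m₁] =ᵐ[ν] ν[f ∘ X | m₂]} =
        {f | condExpL1CLM ℝ hm₁ ν (Lp.compMeasurePreserving X hmp f) =
          condExpL1CLM ℝ hm₂ ν (Lp.compMeasurePreserving X hmp f)} := by
      ext f
      constructor
      · intro h
        exact Lp.ext ((key f).symm.trans (Filter.EventuallyEq.trans h (key' f)))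
      · intro h
        refine (key f).trans (Filter.EventuallyEq.trans ?_ (key' f).symm)
        rw [h]
    rw [this]
    exact isClosed_eq ((condExpL1CLM ℝ hm₁ ν).continuous.comp hQ)
      ((condExpL1CLM ℝ hm₂ ν).continuous.comp hQ)
  · intro f g hfg hf hP
    have : f ∘ X =ᵐ[ν] g ∘ X := hmp.quasiMeasurePreserving.ae_eq_comp hfg
    exact (condExp_congr_ae this).symm.trans (Filter.EventuallyEq.trans hP (condExp_congr_ae this))

end Gauss

section Proj

variable {ι : Type*} [Fintype ι] [DecidableEq ι]

/-- Diagonal 0/1 matrix. -/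
noncomputable def dmask (s : Set ι) : Matrix ι ι ℝ := by
  classical exact Matrix.diagonal (fun p => if p ∈ s then 1 else 0)

lemma dmask_sq (s : Set ι) : dmask s * dmask s = dmask s := by
  simp [dmask, Matrix.diagonal_mul_diagonal]

lemma dmask_tr (s : Set ι) : (dmask s)ᵀ = dmask s := by
  simp [dmask]

lemma exists_proj {α : Type*} {C : Matrix ι ι ℝ} (hC : C.PosDef) (s : Set ι)
    (V : Matrix α ι ℝ) :
    ∃ P : Matrix α ι ℝ, P * dmask s = P ∧ (V - P) * C * dmask s = 0 := by
  set m := dmask s with hm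
  have hmm : m * m = m := dmask_sq s
  have hmt : mᵀ = m := dmask_tr s
  set M := m * C * m + (1 - m) with hM
  have h1 : m * M = m * C * m := by
    simp only [hM, Matrix.mul_add, Matrix.mul_sub, ← Matrix.mul_assoc, hmm]
    simp
  have h2 : M * m = m * C * m := by
    simp only [hM, Matrix.add_mul, Matrix.sub_mul, Matrix.mul_assoc, hmm]
    simp
  have hinj : Function.Injective M.mulVec := by
    rw [← Matrix.coe_mulVecLin, ← LinearMap.ker_eq_bot, LinearMap.ker_eq_bot']
    intro v hv
    simp only [Matrix.mulVecLin_apply] at hv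
    have h3 : m *ᵥ (C *ᵥ (m *ᵥ v)) = 0 := by
      have : (m * M) *ᵥ v = 0 := by rw [← Matrix.mulVec_mulVec, hv, Matrix.mulVec_zero]
      rw [h1] at this
      simpa [Matrix.mulVec_mulVec, Matrix.mul_assoc] using this
    have h4 : m *ᵥ v = 0 := by
      by_contra hne
      have hp := hC.dotProduct_mulVec_pos hne
      have : (m *ᵥ v) ⬝ᵥ C *ᵥ (m *ᵥ v) = 0 := by
        rw [dotProduct_comm, Matrix.dotProduct_mulVec, ← Matrix.mulVec_transpose, hmt, h3]
        simp
      simp only [star_trivial] at hp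
      linarith
    rw [hM, Matrix.add_mulVec, Matrix.sub_mulVec, ← Matrix.mulVec_mulVec, h4] at hv
    simpa using hv
  have hu : IsUnit M := Matrix.mulVec_injective_iff_isUnit.1 hinj
  have hdet : IsUnit M.det := (Matrix.isUnit_iff_isUnit_det M).1 hu
  have hc : m * M⁻¹ = M⁻¹ * m := by
    have h5 : M⁻¹ * (m * M) * M⁻¹ = M⁻¹ * (M * m) * M⁻¹ := by rw [h1, h2]
    have h6 : M⁻¹ * (m * M) * M⁻¹ = M⁻¹ * m := by
      rw [Matrix.mul_assoc, Matrix.mul_assoc m, Matrix.mul_nonsing_inv M hdet, Matrix.mul_one]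
    have h7 : M⁻¹ * (M * m) * M⁻¹ = m * M⁻¹ := by
      rw [← Matrix.mul_assoc M⁻¹, Matrix.nonsing_inv_mul M hdet, Matrix.one_mul]
    rw [← h6, ← h7, h5]
  have hP : V * C * m * M⁻¹ * m = V * C * m * M⁻¹ := by
    rw [Matrix.mul_assoc (V * C * m), ← hc, ← Matrix.mul_assoc, Matrix.mul_assoc (V * C), hmm]
  refine ⟨V * C * m * M⁻¹, hP, ?_⟩
  rw [Matrix.sub_mul, Matrix.sub_mul, sub_eq_zero]
  conv_rhs => rw [← hP]
  rw [Matrix.mul_assoc _ m C, Matrix.mul_assoc _ (m * C) m, ← h2, Matrix.mul_assoc _ M⁻¹,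
    ← Matrix.mul_assoc M⁻¹, Matrix.nonsing_inv_mul M hdet, Matrix.one_mul, Matrix.mul_assoc _ m m, hmm]

end Proj

section Cond

variable {N d : ℕ} {μ : Measure Ω} {x : ℕ → Ω → Fin d → ℝ}
  {C : Matrix (Fin (N + 1) × Fin d) (Fin (N + 1) × Fin d) ℝ}

/-- Row selector of the block `k`. -/
def Xr (N d k : ℕ) : Matrix (Fin d) (Fin (N + 1) × Fin d) ℝ :=
  fun a p => if (p.1 : ℕ) = k ∧ p.2 = a then 1 else 0

/-- Mask of a set of times. -/
noncomputable def tmask (N d : ℕ) (S : Set ℕ) :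
    Matrix (Fin (N + 1) × Fin d) (Fin (N + 1) × Fin d) ℝ :=
  dmask {p | (p.1 : ℕ) ∈ S}

open Classical in
lemma mul_tmask_apply {α : Type*} (P : Matrix α (Fin (N + 1) × Fin d) ℝ) (S : Set ℕ) (a : α)
    (p : Fin (N + 1) × Fin d) :
    (P * tmask N d S) a p = if (p.1 : ℕ) ∈ S then P a p else 0 := by
  simp [tmask, dmask, Matrix.mul_diagonal]

open Classical in
lemma tmask_mulVec_apply (v : Fin (N + 1) × Fin d → ℝ) (S : Set ℕ)
    (p : Fin (N + 1) × Fin d) :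
    (tmask N d S *ᵥ v) p = if (p.1 : ℕ) ∈ S then v p else 0 := by
  simp [tmask, dmask, Matrix.mulVec_diagonal]

lemma Xr_apply_of_le {k : ℕ} (hk : k ≤ N) (a : Fin d) (p : Fin (N + 1) × Fin d) :
    Xr N d k a p = if p = (⟨k, by omega⟩, a) then 1 else 0 := by
  unfold Xr
  obtain ⟨i, b⟩ := p
  simp only [Prod.mk.injEq, Fin.ext_iff]

lemma Xr_mulVec {k : ℕ} (hk : k ≤ N) (v : Fin (N + 1) × Fin d → ℝ) (a : Fin d) :
    (Xr N d k *ᵥ v) a = v (⟨k, by omega⟩, a) := by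
  simp [mulVec, dotProduct, Xr_apply_of_le hk]

lemma mul_XrT {α : Type*} {k : ℕ} (hk : k ≤ N) (P : Matrix α (Fin (N + 1) × Fin d) ℝ)
    (a : α) (b : Fin d) :
    (P * (Xr N d k)ᵀ) a b = P a (⟨k, by omega⟩, b) := by
  simp [Matrix.mul_apply, Xr_apply_of_le hk]

lemma stack_meas (hx : ∀ k, k ≤ N → Measurable (x k)) : Measurable (stack N d x) := by
  refine measurable_pi_lambda _ fun p => ?_
  exact (measurable_pi_apply p.2).comp (hx p.1 (by have := p.1.isLt; omega))

lemma sigma_eq {S : Set ℕ} (hS : ∀ i ∈ S, i ≤ N) :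
    sigmaOf x S = MeasurableSpace.comap (fun ω => tmask N d S *ᵥ stack N d x ω) inferInstance := by
  apply le_antisymm
  · refine iSup₂_le fun i hi => ?_
    have : x i = (fun (y : Fin (N + 1) × Fin d → ℝ) a => y (⟨i, by have := hS i hi; omega⟩, a)) ∘
        (fun ω => tmask N d S *ᵥ stack N d x ω) := by
      ext ω a
      simp [tmask_mulVec_apply, hi, stack]
    rw [this, ← MeasurableSpace.comap_comp]
    exact MeasurableSpace.comap_mono (Measurable.comap_le (by fun_prop))
  · refine Measurable.comap_le ?_
    refine @measurable_pi_lambda _ _ _ (sigmaOf x S) _ _ fun p => ?_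
    by_cases hp : (p.1 : ℕ) ∈ S
    · have h1 : Measurable[sigmaOf x S] (x p.1) := by
        refine Measurable.mono (comap_measurable (x p.1)) ?_ le_rfl
        exact le_iSup₂_of_le (p.1 : ℕ) hp le_rfl
      have : (fun ω => (tmask N d S *ᵥ stack N d x ω) p) = (fun y : Fin d → ℝ => y p.2) ∘ x p.1 := by
        ext ω
        simp [tmask_mulVec_apply, hp, stack]
      rw [this]
      exact (measurable_pi_apply p.2).comp h1
    · have : (fun ω => (tmask N d S *ᵥ stack N d x ω) p) = fun _ => 0 := by
        ext ω
        simp [tmask_mulVec_apply, hp]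
      rw [this]
      exact measurable_const

lemma condExp_ind [IsProbabilityMeasure μ] (hx : ZMNG N d μ x C) {k : ℕ} (hk : k ≤ N) {S : Set ℕ}
    (hS : ∀ i ∈ S, i ≤ N) (P : Matrix (Fin d) (Fin (N + 1) × Fin d) ℝ)
    (hP : P * tmask N d S = P) (hR : (Xr N d k - P) * C * tmask N d S = 0)
    {A : Set (Fin d → ℝ)} (hA : MeasurableSet A) :
    (fun ω => ∫ r, A.indicator (fun _ => (1 : ℝ)) (P *ᵥ stack N d x ω + r)
        ∂(μ.map fun ω => (Xr N d k - P) *ᵥ stack N d x ω)) =ᵐ[μ]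
      μ[A.indicator (fun _ => (1 : ℝ)) ∘ x k | sigmaOf x S] := by
  obtain ⟨hm, hG, hC⟩ := hx
  have hz := stack_meas hm
  have hI := indep_of_cov (μ := μ) hz hG hC.posSemidef (tmask N d S) (Xr N d k - P) (by
    have := congrArg Matrix.transpose hR
    have hCt : Cᵀ = C := by simpa using hC.isHermitian.eq
    rw [Matrix.transpose_mul, Matrix.transpose_mul, hCt, tmask, dmask_tr, Matrix.transpose_zero,
      ← Matrix.mul_assoc] at this
    exact this)
  have hmu : ∀ (α : Type) [Fintype α] (M : Matrix α (Fin (N + 1) × Fin d) ℝ),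
      Measurable (fun v => M *ᵥ v) := by
    intro α _ M
    refine measurable_pi_lambda _ fun i => ?_
    simp only [mulVec, dotProduct]
    fun_prop
  have hD : MeasurableSet {p : (Fin (N + 1) × Fin d → ℝ) × (Fin d → ℝ) | P *ᵥ p.1 + p.2 ∈ A} :=
    (((hmu _ P).comp measurable_fst).add measurable_snd) hA
  have hf := freeze ((hmu _ (tmask N d S)).comp hz) ((hmu _ (Xr N d k - P)).comp hz) hI _ hD
  rw [sigma_eq hS]
  have hi : ∀ ω r, A.indicator (fun _ => (1 : ℝ)) (P *ᵥ stack N d x ω + r) =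
      {p : (Fin (N + 1) × Fin d → ℝ) × (Fin d → ℝ) | P *ᵥ p.1 + p.2 ∈ A}.indicator
        (fun _ => (1 : ℝ)) (tmask N d S *ᵥ stack N d x ω, r) := by
    intro ω r
    by_cases h : P *ᵥ stack N d x ω + r ∈ A
    · rw [Set.indicator_of_mem h, Set.indicator_of_mem]
      change P *ᵥ (tmask N d S *ᵥ stack N d x ω) + r ∈ A
      rwa [Matrix.mulVec_mulVec, hP]
    · rw [Set.indicator_of_notMem h, Set.indicator_of_notMem]
      change ¬ (P *ᵥ (tmask N d S *ᵥ stack N d x ω) + r ∈ A)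
      rwa [Matrix.mulVec_mulVec, hP]
  have hk' : A.indicator (fun _ => (1 : ℝ)) ∘ x k = fun ω =>
      {p : (Fin (N + 1) × Fin d → ℝ) × (Fin d → ℝ) | P *ᵥ p.1 + p.2 ∈ A}.indicator
        (fun _ => (1 : ℝ)) (tmask N d S *ᵥ stack N d x ω, (Xr N d k - P) *ᵥ stack N d x ω) := by
    funext ω
    have : x k ω = P *ᵥ stack N d x ω + (Xr N d k - P) *ᵥ stack N d x ω := by
      rw [Matrix.sub_mulVec]
      ext a
      simp [Xr_mulVec hk, stack]
    rw [← hi, ← this]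
    rfl
  simp only [hi]
  rw [hk']
  exact hf

lemma condEq_of [IsProbabilityMeasure μ] (hx : ZMNG N d μ x C) {k : ℕ} (hk : k ≤ N) {S T : Set ℕ}
    (hS : ∀ i ∈ S, i ≤ N) (hT : T ⊆ S) (P : Matrix (Fin d) (Fin (N + 1) × Fin d) ℝ)
    (hP : P * tmask N d T = P) (hR : (Xr N d k - P) * C * tmask N d S = 0) :
    CondEq μ x k S T := by
  intro A hA
  have h1 : P * tmask N d S = P := by
    ext a p
    have := congrFun (congrFun hP a) p
    rw [mul_tmask_apply] at this ⊢
    by_cases h : (p.1 : ℕ) ∈ T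
    · simp [hT h]
    · rw [if_neg h] at this
      simp [← this]
  have h2 : (Xr N d k - P) * C * tmask N d T = 0 := by
    ext a p
    have := congrFun (congrFun hR a) p
    rw [mul_tmask_apply] at this ⊢
    by_cases h : (p.1 : ℕ) ∈ T
    · simpa [hT h, h] using this
    · simp [h]
  exact (condExp_ind hx hk hS P h1 hR hA).symm.trans
    (condExp_ind hx hk (fun i hi => hS i (hT hi)) P hP h2 hA)

lemma condExp_lin [IsProbabilityMeasure μ] (hx : ZMNG N d μ x C) {k : ℕ} (hk : k ≤ N) {S : Set ℕ}
    (hS : ∀ i ∈ S, i ≤ N) (P : Matrix (Fin d) (Fin (N + 1) × Fin d) ℝ)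
    (hP : P * tmask N d S = P) (hR : (Xr N d k - P) * C * tmask N d S = 0) (a : Fin d) :
    μ[fun ω => x k ω a | sigmaOf x S] =ᵐ[μ] Lf (stack N d x) (P a) := by
  obtain ⟨hm, hG, hC⟩ := hx
  have hz := stack_meas hm
  have hI := indep_of_cov (μ := μ) hz hG hC.posSemidef (Xr N d k - P) (tmask N d S) (by
    rw [tmask, dmask_tr]; exact hR)
  have hdec : (fun ω => x k ω a) =
      Lf (stack N d x) (P a) + Lf (stack N d x) ((Xr N d k - P) a) := by
    rw [← Lf_add]
    ext ω
    have := Xr_mulVec (d := d) hk (stack N d x ω) a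
    simp only [mulVec, dotProduct, stack] at this
    simp [Lf, stack, this]
  have hle : sigmaOf x S ≤ ‹MeasurableSpace Ω› := by
    refine iSup₂_le fun i hi => (hm i (hS i hi)).comap_le
  have hi : ∀ u, Integrable (Lf (stack N d x) u) μ := fun u =>
    (Lf_memLp hz hG u).integrable (by norm_num)
  rw [hdec]
  refine (condExp_add (hi _) (hi _) _).trans ?_
  have e1 : μ[Lf (stack N d x) (P a) | sigmaOf x S] = Lf (stack N d x) (P a) := by
    refine condExp_of_stronglyMeasurable hle ?_ (hi _)
    have : Lf (stack N d x) (P a) = (fun y => ∑ p, P a p * y p) ∘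
        (fun ω => tmask N d S *ᵥ stack N d x ω) := by
      ext ω
      have := congrFun (Matrix.mulVec_mulVec (stack N d x ω) P (tmask N d S)) a
      rw [hP] at this
      exact this.symm
    rw [sigma_eq hS, this]
    refine Measurable.stronglyMeasurable ?_
    exact Measurable.comp (by fun_prop) (comap_measurable _)
  have e2 : μ[Lf (stack N d x) ((Xr N d k - P) a) | sigmaOf x S] =ᵐ[μ] fun _ => 0 := by
    have hme : Measurable (fun y : Fin d → ℝ => y a) := measurable_pi_apply a
    have hI' : IndepFun (Lf (stack N d x) ((Xr N d k - P) a))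
        (fun ω => tmask N d S *ᵥ stack N d x ω) μ :=
      hI.comp (φ := fun y : Fin d → ℝ => y a) (ψ := id) hme measurable_id
    have := condExp_indep_eq (μ := μ) (m₁ := MeasurableSpace.comap (Lf (stack N d x) ((Xr N d k - P) a)) inferInstance)
      (m₂ := sigmaOf x S) (f := Lf (stack N d x) ((Xr N d k - P) a))
      (Lf_measurable hz _).comap_le hle (comap_measurable _).stronglyMeasurable (by
        rw [sigma_eq hS]; exact hI')
    rwa [Lf_mean hz hG] at this
  rw [e1]
  filter_upwards [e2] with ω h
  simp [h]

lemma Lf_ae_eq [IsProbabilityMeasure μ] (hx : ZMNG N d μ x C) {u v : Fin (N + 1) × Fin d → ℝ}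
    (h : Lf (stack N d x) u =ᵐ[μ] Lf (stack N d x) v) : u = v := by
  obtain ⟨hm, hG, hC⟩ := hx
  have hz := stack_meas hm
  by_contra hne
  have hp := hC.dotProduct_mulVec_pos (sub_ne_zero.2 hne)
  simp only [star_trivial] at hp
  have hv := Lf_var hz hG hC.posSemidef (u - v)
  have h0 : Lf (stack N d x) (u - v) =ᵐ[μ] 0 := by
    rw [Lf_sub]
    filter_upwards [h] with ω hω
    simp [hω]
  rw [variance_congr h0, variance_zero] at hv
  linarith

lemma condEq_imp [IsProbabilityMeasure μ] (hx : ZMNG N d μ x C) {k : ℕ} (hk : k ≤ N) {S T : Set ℕ}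
    (hS : ∀ i ∈ S, i ≤ N) (hT : ∀ i ∈ T, i ≤ N) (h : CondEq μ x k S T) :
    ∃ P : Matrix (Fin d) (Fin (N + 1) × Fin d) ℝ,
      P * tmask N d T = P ∧ (Xr N d k - P) * C * tmask N d S = 0 := by
  obtain ⟨P, hP, hR⟩ := exists_proj hx.2.2 {p | (p.1 : ℕ) ∈ S} (Xr N d k)
  obtain ⟨Q, hQ, hR'⟩ := exists_proj hx.2.2 {p | (p.1 : ℕ) ∈ T} (Xr N d k)
  have hPQ : P = Q := by
    funext a
    apply Lf_ae_eq hx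
    have hle : ∀ S : Set ℕ, (∀ i ∈ S, i ≤ N) → sigmaOf x S ≤ ‹MeasurableSpace Ω› := fun S hS =>
      iSup₂_le fun i hi => (hx.1 i (hS i hi)).comap_le
    refine (condExp_lin hx hk hS P hP hR a).symm.trans (Filter.EventuallyEq.trans ?_ (condExp_lin hx hk hT Q hQ hR' a))
    refine condExp_transfer (f := fun y : Fin d → ℝ => y a) (hle S hS) (hle T hT) (hx.1 k hk) h ?_
    have hme : Measurable (fun y : Fin d → ℝ => y a) := measurable_pi_apply a
    rw [integrable_map_measure hme.aestronglyMeasurable (hx.1 k hk).aemeasurable]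
    have := (Lf_memLp (stack_meas hx.1) hx.2.1 (Xr N d k a)).integrable (by norm_num)
    convert this using 1
    ext ω
    have := Xr_mulVec (d := d) hk (stack N d x ω) a
    simp only [mulVec, dotProduct, stack] at this
    simp [Lf, stack, this]
  exact ⟨P, hPQ ▸ hQ, hR⟩

lemma orth_iff {α : Type*} {S : Set ℕ} (hS : ∀ i ∈ S, i ≤ N)
    (R : Matrix α (Fin (N + 1) × Fin d) ℝ) :
    R * C * tmask N d S = 0 ↔ ∀ i ∈ S, R * C * (Xr N d i)ᵀ = 0 := by
  constructor
  · intro h i hi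
    ext a b
    rw [mul_XrT (hS i hi)]
    have := congrFun (congrFun h a) (⟨i, by have := hS i hi; omega⟩, b)
    rw [mul_tmask_apply] at this
    simpa [hi] using this
  · intro h
    ext a p
    rw [mul_tmask_apply]
    split_ifs with hp
    · have := congrFun (congrFun (h _ hp) a) p.2
      rwa [mul_XrT (hS _ hp)] at this
    · rfl

lemma Xr_tmask {S : Set ℕ} {j : ℕ} (hj : j ∈ S) : Xr N d j * tmask N d S = Xr N d j := by
  ext a p
  rw [mul_tmask_apply]
  split_ifs with hp
  · rfl
  · unfold Xr
    rw [if_neg]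
    · rintro ⟨rfl, _⟩
      exact hp hj

lemma supp_pair {j c : ℕ} (hj : j ≤ N) (hc : c ≤ N) (P : Matrix (Fin d) (Fin (N + 1) × Fin d) ℝ) :
    P * tmask N d ({j} ∪ {c}) = P ↔ ∃ M₁ M₂ : Mat d, P = M₁ * Xr N d j + M₂ * Xr N d c := by
  constructor
  · intro h
    refine ⟨P * (Xr N d j)ᵀ, if j = c then 0 else P * (Xr N d c)ᵀ, ?_⟩
    ext a p
    have := congrFun (congrFun h a) p
    rw [mul_tmask_apply] at this
    rw [← this]
    have key : ∀ i (hi : i ≤ N), (P * (Xr N d i)ᵀ * Xr N d i) a p = if (p.1 : ℕ) = i then P a p else 0 := by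
      intro i hi
      rw [Matrix.mul_apply]
      simp only [mul_XrT hi]
      unfold Xr
      split_ifs with hp
      · subst hp
        simp
      · simp [hp]
    by_cases hjc : j = c
    · subst hjc
      simp [key j hj]
    · rw [if_neg hjc, Matrix.add_apply, key j hj, key c hc]
      by_cases h1 : (p.1 : ℕ) = j
      · have : (p.1 : ℕ) ≠ c := by omega
        simp [h1, hjc]
      · simp [h1]
  · rintro ⟨M₁, M₂, rfl⟩
    rw [Matrix.add_mul, Matrix.mul_assoc, Matrix.mul_assoc, Xr_tmask (by simp), Xr_tmask (by simp)]

lemma condEq_iff [IsProbabilityMeasure μ] (hx : ZMNG N d μ x C) {k j c : ℕ} (hk : k ≤ N) {S : Set ℕ}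
    (hS : ∀ i ∈ S, i ≤ N) (hj : j ∈ S) (hc : c ∈ S) :
    CondEq μ x k S ({j} ∪ {c}) ↔ ∃ M₁ M₂ : Mat d, ∀ i ∈ S,
      (Xr N d k - (M₁ * Xr N d j + M₂ * Xr N d c)) * C * (Xr N d i)ᵀ = 0 := by
  have hT : ({j} ∪ {c} : Set ℕ) ⊆ S := by
    rintro i (h | h) <;> · rw [Set.mem_singleton_iff] at h; subst h; assumption
  constructor
  · intro h
    obtain ⟨P, hP, hR⟩ := condEq_imp hx hk hS (fun i hi => hS i (hT hi)) h
    obtain ⟨M₁, M₂, rfl⟩ := (supp_pair (hS j hj) (hS c hc) P).1 hP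
    exact ⟨M₁, M₂, (orth_iff hS _).1 hR⟩
  · rintro ⟨M₁, M₂, h⟩
    exact condEq_of hx hk hS hT _ ((supp_pair (hS j hj) (hS c hc) _).2 ⟨M₁, M₂, rfl⟩)
      ((orth_iff hS _).2 h)

end Cond

section Alg

variable {N d : ℕ} {C : Matrix (Fin (N + 1) × Fin d) (Fin (N + 1) × Fin d) ℝ}
  {Gm GN Gcov : ℕ → Mat d}

/-- Cross covariance of two coefficient blocks. -/
def cv {α β : Type*} (C : Matrix (Fin (N + 1) × Fin d) (Fin (N + 1) × Fin d) ℝ)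
    (U : Matrix α (Fin (N + 1) × Fin d) ℝ) (V : Matrix β (Fin (N + 1) × Fin d) ℝ) :
    Matrix α β ℝ := U * C * Vᵀ

section cvlemmas
variable (U U' V V' : Matrix (Fin d) (Fin (N + 1) × Fin d) ℝ) (M : Mat d)

lemma cv_add_left : cv C (U + U') V = cv C U V + cv C U' V := by
  simp [cv, Matrix.add_mul]
lemma cv_sub_left : cv C (U - U') V = cv C U V - cv C U' V := by
  simp [cv, Matrix.sub_mul]
lemma cv_mul_left : cv C (M * U) V = M * cv C U V := by
  simp [cv, Matrix.mul_assoc]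
lemma cv_add_right : cv C U (V + V') = cv C U V + cv C U V' := by
  simp [cv, Matrix.mul_add]
lemma cv_sub_right : cv C U (V - V') = cv C U V - cv C U V' := by
  simp [cv, Matrix.mul_sub]
lemma cv_mul_right : cv C U (M * V) = cv C U V * Mᵀ := by
  simp [cv, Matrix.mul_assoc, Matrix.transpose_mul]
lemma cv_symm (hC : C.PosDef) : (cv C U V)ᵀ = cv C V U := by
  have hCt : Cᵀ = C := by simpa using hC.isHermitian.eq
  simp [cv, Matrix.mul_assoc, Matrix.transpose_mul, hCt]
lemma cv_symm_zero (hC : C.PosDef) (h : cv C U V = 0) : cv C V U = 0 := by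
  rw [← cv_symm _ _ hC, h, Matrix.transpose_zero]

lemma cv_posDef (hC : C.PosDef) (h : ∃ W : Matrix (Fin (N + 1) × Fin d) (Fin d) ℝ, U * W = 1) :
    (cv C U U).PosDef := by
  obtain ⟨W, hW⟩ := h
  have := hC.mul_mul_conjTranspose_same (B := U) (by
    intro v w hvw
    have := congrArg (fun y => y ᵥ* W) hvw
    simpa [Matrix.vecMul_vecMul, hW] using this)
  simpa [cv] using this
end cvlemmas

lemma Xr_mul_XrT {i j : ℕ} (hj : j ≤ N) : Xr N d i * (Xr N d j)ᵀ = if i = j then 1 else 0 := by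
  ext a b
  rw [mul_XrT hj]
  unfold Xr
  by_cases h : i = j
  · subst h
    simp [Matrix.one_apply, eq_comm]
  · simp [h, Ne.symm h]

/-- Coefficient block of the noise `e_k`. -/
def Er (N d : ℕ) (Gm GN : ℕ → Mat d) (k : ℕ) : Matrix (Fin d) (Fin (N + 1) × Fin d) ℝ :=
  if k = N then Xr N d N else if k = 0 then Xr N d 0 - GN 0 * Xr N d N
  else Xr N d k - (Gm k * Xr N d (k - 1) + GN k * Xr N d N)

lemma Er_N : Er N d Gm GN N = Xr N d N := by simp [Er]

lemma Er_zero (hN : 0 < N) : Er N d Gm GN 0 = Xr N d 0 - GN 0 * Xr N d N := by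
  simp [Er, hN.ne]

lemma Er_mid {k : ℕ} (h1 : 1 ≤ k) (h2 : k < N) :
    Er N d Gm GN k = Xr N d k - (Gm k * Xr N d (k - 1) + GN k * Xr N d N) := by
  simp [Er, h2.ne, (show k ≠ 0 by omega)]

/-- The algebraic content of the `CM_L` model. -/
structure Core (N d : ℕ) (C : Matrix (Fin (N + 1) × Fin d) (Fin (N + 1) × Fin d) ℝ)
    (Gm GN Gcov : ℕ → Mat d) : Prop where
  orth : ∀ k < N, ∀ i, (i < k ∨ i = N) → cv C (Er N d Gm GN k) (Xr N d i) = 0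
  cov : ∀ k ≤ N, cv C (Er N d Gm GN k) (Er N d Gm GN k) = Gcov k
  pos : ∀ k ≤ N, (Gcov k).PosDef

lemma orth_Er (U : Matrix (Fin d) (Fin (N + 1) × Fin d) ℝ) (k : ℕ) (hk : k ≤ N)
    (h : ∀ i, (i < k ∨ i = N) → cv C U (Xr N d i) = 0) (j : ℕ) (hj : j < k ∨ j = N) (hN : 0 < N) :
    cv C U (Er N d Gm GN j) = 0 := by
  rcases hj with hj | rfl
  · rcases Nat.eq_zero_or_pos j with rfl | h0
    · rw [Er_zero hN, cv_sub_right, cv_mul_right, h _ (Or.inl hj), h _ (Or.inr rfl)]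
      simp
    · rw [Er_mid h0 (by omega), cv_sub_right, cv_add_right, cv_mul_right, cv_mul_right,
        h _ (Or.inl hj), h _ (Or.inr rfl), h _ (Or.inl (by omega))]
      simp
  · rw [Er_N, h _ (Or.inr rfl)]

lemma Core.uncorr (hC : C.PosDef) (hN : 0 < N) (hc : Core N d C Gm GN Gcov) {i j : ℕ} (hi : i ≤ N)
    (hj : j ≤ N) (hij : i ≠ j) : cv C (Er N d Gm GN i) (Er N d Gm GN j) = 0 := by
  have key : ∀ i j, i ≤ N → j ≤ N → (j < i ∧ i < N ∨ (j = N ∧ i < N)) →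
      cv C (Er N d Gm GN i) (Er N d Gm GN j) = 0 := by
    intro i j hi hj h
    exact orth_Er _ i hi (hc.orth i (by omega)) j (by omega) hN
  by_cases h : (j < i ∧ i < N ∨ (j = N ∧ i < N))
  · exact key i j hi hj h
  · exact cv_symm_zero _ _ hC (key j i hj hi (by omega))

lemma Core.of_uncorr (hN : 0 < N)
    (h : ∀ i j, i ≤ N → j ≤ N → i ≠ j → cv C (Er N d Gm GN i) (Er N d Gm GN j) = 0)
    (hcov : ∀ k ≤ N, cv C (Er N d Gm GN k) (Er N d Gm GN k) = Gcov k)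
    (hpos : ∀ k ≤ N, (Gcov k).PosDef) : Core N d C Gm GN Gcov := by
  refine ⟨?_, hcov, hpos⟩
  intro k hk
  have hXN : cv C (Er N d Gm GN k) (Xr N d N) = 0 := by
    rw [← Er_N (Gm := Gm) (GN := GN)]
    exact h k N hk.le le_rfl hk.ne
  have hlt : ∀ i, i < k → cv C (Er N d Gm GN k) (Xr N d i) = 0 := by
    intro i
    induction i with
    | zero =>
      intro hi
      have := h k 0 hk.le (by omega) (by omega)
      rw [Er_zero hN, cv_sub_right, cv_mul_right, hXN] at this
      simpa using this
    | succ i ih =>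
      intro hi
      have := h k (i + 1) hk.le (by omega) (by omega)
      rw [Er_mid (k := i + 1) (by omega) (by omega), cv_sub_right, cv_add_right, cv_mul_right, cv_mul_right, hXN,
        Nat.add_sub_cancel, ih (by omega)] at this
      simpa using this
  rintro i (hi | rfl)
  · exact hlt i hi
  · exact hXN

lemma Core.diag (hc : Core N d C Gm GN Gcov) {k : ℕ} (h1 : 1 ≤ k) (h2 : k < N) :
    cv C (Er N d Gm GN k) (Xr N d k) = Gcov k := by
  have := hc.cov k h2.le
  conv_lhs at this => arg 3; rw [Er_mid h1 h2]
  rw [cv_sub_right, cv_add_right, cv_mul_right, cv_mul_right, hc.orth k h2 _ (Or.inr rfl),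
    hc.orth k h2 (k - 1) (Or.inl (by omega))] at this
  simpa using this

/-- Dual block. -/
noncomputable def Yr (N d : ℕ) (Gm GN Gcov : ℕ → Mat d) (k : ℕ) :
    Matrix (Fin d) (Fin (N + 1) × Fin d) ℝ :=
  (Gcov k)⁻¹ * Er N d Gm GN k - ((Gm (k + 1))ᵀ * (Gcov (k + 1))⁻¹) * Er N d Gm GN (k + 1)

lemma posDef_inv_mul {A : Mat d} (h : A.PosDef) : A⁻¹ * A = 1 :=
  Matrix.nonsing_inv_mul A ((Matrix.isUnit_iff_isUnit_det A).1 h.isUnit)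

lemma eq_of_mul_XrT {U V : Matrix (Fin d) (Fin (N + 1) × Fin d) ℝ}
    (h : ∀ j ≤ N, U * (Xr N d j)ᵀ = V * (Xr N d j)ᵀ) : U = V := by
  ext a p
  have hp : (p.1 : ℕ) ≤ N := by have := p.1.isLt; omega
  have := congrFun (congrFun (h p.1 hp) a) p.2
  rwa [mul_XrT hp, mul_XrT hp] at this

lemma Core.dual (hC : C.PosDef) (hc : Core N d C Gm GN Gcov) {k : ℕ} (h1 : 1 ≤ k)
    (h2 : k + 2 ≤ N) : Yr N d Gm GN Gcov k * C = Xr N d k := by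
  have hcv : ∀ V : Matrix (Fin d) (Fin (N + 1) × Fin d) ℝ, cv C (Yr N d Gm GN Gcov k) V =
      (Gcov k)⁻¹ * cv C (Er N d Gm GN k) V -
        ((Gm (k + 1))ᵀ * (Gcov (k + 1))⁻¹) * cv C (Er N d Gm GN (k + 1)) V := by
    intro V
    rw [Yr, cv_sub_left, cv_mul_left, cv_mul_left]
  have hlow : ∀ j, (j < k ∨ j = N) → cv C (Yr N d Gm GN Gcov k) (Xr N d j) = 0 := by
    intro j hj
    rw [hcv, hc.orth k (by omega) j hj, hc.orth (k + 1) (by omega) j (by omega)]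
    simp
  have hk : cv C (Yr N d Gm GN Gcov k) (Xr N d k) = 1 := by
    rw [hcv, hc.diag h1 (by omega), hc.orth (k + 1) (by omega) k (by omega),
      posDef_inv_mul (hc.pos k (by omega))]
    simp
  have hE : ∀ j, k + 2 ≤ j → j ≤ N → cv C (Yr N d Gm GN Gcov k) (Er N d Gm GN j) = 0 := by
    intro j hj hjN
    rw [hcv, hc.uncorr hC (by omega) (by omega) hjN (by omega),
      hc.uncorr hC (by omega) (by omega) hjN (by omega)]
    simp
  have hE1 : cv C (Yr N d Gm GN Gcov k) (Er N d Gm GN (k + 1)) = - (Gm (k + 1))ᵀ := by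
    rw [hcv, hc.uncorr hC (by omega) (by omega) (by omega) (by omega), hc.cov _ (by omega),
      Matrix.mul_assoc, posDef_inv_mul (hc.pos (k + 1) (by omega))]
    simp
  have hk1 : cv C (Yr N d Gm GN Gcov k) (Xr N d (k + 1)) = 0 := by
    have := hE1
    rw [Er_mid (by omega) (by omega), cv_sub_right, cv_add_right, cv_mul_right, cv_mul_right,
      Nat.add_sub_cancel, hk, hlow N (Or.inr rfl)] at this
    simpa using this
  have hhigh : ∀ j, k + 1 ≤ j → j < N → cv C (Yr N d Gm GN Gcov k) (Xr N d j) = 0 := by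
    intro j hj
    induction j, hj using Nat.le_induction with
    | base => intro _; exact hk1
    | succ j hj ih =>
      intro hjN
      have := hE (j + 1) (by omega) (by omega)
      rw [Er_mid (by omega) (by omega), cv_sub_right, cv_add_right, cv_mul_right, cv_mul_right,
        Nat.add_sub_cancel, ih (by omega), hlow N (Or.inr rfl)] at this
      simpa using this
  apply eq_of_mul_XrT
  intro j hj
  rw [Xr_mul_XrT hj]
  change cv C (Yr N d Gm GN Gcov k) (Xr N d j) = _
  split_ifs with h
  · subst h; exact hk
  · by_cases hh : j < k ∨ j = N
    · exact hlow j hh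
    · exact hhigh j (by omega) (by omega)

lemma Yr_eq {k : ℕ} (h1 : 1 ≤ k) (h2 : k + 2 ≤ N) :
    ∃ A B F : Mat d, Yr N d Gm GN Gcov k =
      A * Xr N d k + B * Xr N d (k - 1) + F * Xr N d (k + 1) -
      ((Gcov k)⁻¹ * GN k - (Gm (k + 1))ᵀ * (Gcov (k + 1))⁻¹ * GN (k + 1)) * Xr N d N := by
  refine ⟨(Gcov k)⁻¹ + (Gm (k + 1))ᵀ * (Gcov (k + 1))⁻¹ * Gm (k + 1), - ((Gcov k)⁻¹ * Gm k),
    - ((Gm (k + 1))ᵀ * (Gcov (k + 1))⁻¹), ?_⟩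
  rw [Yr, Er_mid h1 (by omega), Er_mid (by omega) (by omega), Nat.add_sub_cancel]
  simp only [Matrix.mul_sub, Matrix.mul_add, Matrix.sub_mul, Matrix.add_mul, Matrix.neg_mul,
    Matrix.mul_assoc]
  abel

/-- Algebraic form of CM_L. -/
lemma Core.cml (hc : Core N d C Gm GN Gcov) (j k : ℕ) (hjk : j < k) (hk : k ≤ N) :
    ∃ M₁ M₂ : Mat d, ∀ i ∈ Set.Icc 0 j ∪ {N},
      cv C (Xr N d k - (M₁ * Xr N d j + M₂ * Xr N d N)) (Xr N d i) = 0 := by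
  rcases hk.eq_or_lt with rfl | hk
  · exact ⟨0, 1, fun i _ => by simp [cv]⟩
  · have : ∀ k, j ≤ k → k < N → ∃ M₁ M₂ : Mat d, ∀ i ∈ Set.Icc 0 j ∪ {N},
      cv C (Xr N d k - (M₁ * Xr N d j + M₂ * Xr N d N)) (Xr N d i) = 0 := by
      intro k hjk
      induction k, hjk using Nat.le_induction with
      | base => intro _; exact ⟨1, 0, fun i _ => by simp [cv]⟩
      | succ k hk ih =>
        intro hkN
        obtain ⟨M₁, M₂, h⟩ := ih (by omega)
        refine ⟨Gm (k + 1) * M₁, Gm (k + 1) * M₂ + GN (k + 1), fun i hi => ?_⟩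
        have e : Xr N d (k + 1) - (Gm (k + 1) * M₁ * Xr N d j +
            (Gm (k + 1) * M₂ + GN (k + 1)) * Xr N d N) = Er N d Gm GN (k + 1) +
            Gm (k + 1) * (Xr N d k - (M₁ * Xr N d j + M₂ * Xr N d N)) := by
          rw [Er_mid (by omega) hkN, Nat.add_sub_cancel]
          simp only [Matrix.mul_sub, Matrix.mul_add, Matrix.add_mul, Matrix.mul_assoc]
          abel
        rw [e, cv_add_left, cv_mul_left, h i hi, hc.orth (k + 1) hkN i]
        · simp
        · rcases hi with hi | hi
          · exact Or.inl (by have := hi.2; omega)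
          · exact Or.inr hi
    exact this k hjk.le hk

/-- From CM_F to the parameter condition. -/
lemma Core.cond_of_cmf (hC : C.PosDef) (hc : Core N d C Gm GN Gcov) {k₁ k : ℕ} (h1 : k₁ + 1 ≤ k)
    (h2 : k + 2 ≤ N) (M₁ M₂ : Mat d)
    (h : ∀ i ∈ Set.Icc k₁ (N - 1) ∪ {k₁},
      cv C (Xr N d N - (M₁ * Xr N d (N - 1) + M₂ * Xr N d k₁)) (Xr N d i) = 0) :
    (Gcov k)⁻¹ * GN k = (Gm (k + 1))ᵀ * (Gcov (k + 1))⁻¹ * GN (k + 1) := by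
  set R := Xr N d N - (M₁ * Xr N d (N - 1) + M₂ * Xr N d k₁) with hR
  have h' : ∀ i, k₁ ≤ i → i ≤ N - 1 → cv C (Xr N d i) R = 0 := fun i hi hi' =>
    cv_symm_zero _ _ hC (h i (Or.inl ⟨hi, hi'⟩))
  obtain ⟨A, B, F, hY⟩ := Yr_eq (N := N) (d := d) (Gm := Gm) (GN := GN) (Gcov := Gcov) (k := k)
    (by omega) h2
  have e1 : cv C (Yr N d Gm GN Gcov k) R = 0 := by
    rw [cv, hc.dual hC (by omega) h2, hR, Matrix.transpose_sub, Matrix.transpose_add,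
      Matrix.transpose_mul, Matrix.transpose_mul, Matrix.mul_sub, Matrix.mul_add,
      ← Matrix.mul_assoc, ← Matrix.mul_assoc, Xr_mul_XrT le_rfl, Xr_mul_XrT (by omega),
      Xr_mul_XrT (by omega), if_neg (by omega), if_neg (by omega), if_neg (by omega)]
    simp
  rw [hY, cv_sub_left, cv_add_left, cv_add_left, cv_mul_left, cv_mul_left, cv_mul_left, cv_mul_left,
    h' k (by omega) (by omega), h' (k - 1) (by omega) (by omega),
    h' (k + 1) (by omega) (by omega)] at e1
  have e2 : cv C (Xr N d N) R = cv C R R := by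
    conv_rhs => arg 2; rw [hR]
    rw [cv_sub_left, cv_add_left, cv_mul_left, cv_mul_left, h' (N - 1) (by omega) le_rfl,
      h' k₁ le_rfl (by omega)]
    simp
  have hpd : (cv C R R).PosDef := by
    refine cv_posDef _ hC ⟨(Xr N d N)ᵀ, ?_⟩
    rw [hR, Matrix.sub_mul, Matrix.add_mul, Matrix.mul_assoc, Matrix.mul_assoc,
      Xr_mul_XrT le_rfl, Xr_mul_XrT le_rfl, Xr_mul_XrT le_rfl, if_pos rfl, if_neg (by omega),
      if_neg (by omega)]
    simp
  rw [e2] at e1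
  have hdet := (Matrix.isUnit_iff_isUnit_det _).1 hpd.isUnit
  rw [← sub_eq_zero]
  have := congrArg (fun Z => Z * (cv C R R)⁻¹) e1
  simp only [Matrix.sub_mul, Matrix.mul_assoc, Matrix.mul_nonsing_inv _ hdet] at this
  simpa [Matrix.mul_assoc, sub_eq_zero, eq_comm] using this

/-- From the parameter condition to CM_F. -/
lemma Core.cmf_of_cond (hC : C.PosDef) (hc : Core N d C Gm GN Gcov) {k₁ j k : ℕ}
    (hj : k₁ ≤ j) (hjk : j < k) (hk : k ≤ N)
    (h : ∀ i, k₁ + 1 ≤ i → i ≤ N - 2 →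
      (Gcov i)⁻¹ * GN i = (Gm (i + 1))ᵀ * (Gcov (i + 1))⁻¹ * GN (i + 1)) :
    ∃ M₁ M₂ : Mat d, ∀ i ∈ Set.Icc k₁ j ∪ {k₁},
      cv C (Xr N d k - (M₁ * Xr N d j + M₂ * Xr N d k₁)) (Xr N d i) = 0 := by
  obtain ⟨P, hP, hR⟩ := exists_proj hC {p | (p.1 : ℕ) ∈ ({j} ∪ {k₁} : Set ℕ)} (Xr N d k)
  have hPs := (supp_pair (by omega) (by omega) P).1 hP
  obtain ⟨M₁, M₂, hPM⟩ := hPs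
  set R := Xr N d k - P with hRdef
  have hTN : ∀ i ∈ ({j} ∪ {k₁} : Set ℕ), i ≤ N := by
    rintro i (hi | hi) <;> · rw [Set.mem_singleton_iff] at hi; omega
  have hSN : ∀ i ∈ (Set.Icc k₁ j ∪ {k₁} : Set ℕ), i ≤ N := by
    rintro i (hi | hi)
    · have := hi.2; omega
    · rw [Set.mem_singleton_iff] at hi; omega
  have hRT := (orth_iff hTN R).1 hR
  obtain ⟨u, hu, huR⟩ := exists_proj hC {p | (p.1 : ℕ) ∈ (Set.Icc k₁ j ∪ {k₁} : Set ℕ)} R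
  have huS := (orth_iff hSN (R - u)).1 huR
  suffices hu0 : u = 0 by
    rw [hu0, sub_zero, hRdef, hPM] at huS
    exact ⟨M₁, M₂, huS⟩
  have hint : ∀ i, k₁ < i → i < j → u * (Xr N d i)ᵀ = 0 := by
    intro i h1 h2
    obtain ⟨A, B, F, hY⟩ := Yr_eq (N := N) (d := d) (Gm := Gm) (GN := GN) (Gcov := Gcov) (k := i)
      (by omega) (by omega)
    rw [h i (by omega) (by omega), sub_self, Matrix.zero_mul, sub_zero] at hY
    have e1 : cv C (R - u) (Yr N d Gm GN Gcov i) = 0 := by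
      have hz : ∀ l, k₁ ≤ l → l ≤ j → cv C (R - u) (Xr N d l) = 0 := fun l hl hl' =>
        huS l (Or.inl ⟨hl, hl'⟩)
      rw [hY, cv_add_right, cv_add_right, cv_mul_right, cv_mul_right, cv_mul_right,
        hz i (by omega) (by omega), hz (i - 1) (by omega) (by omega), hz (i + 1) (by omega) (by omega)]
      simp
    have e2 := cv_symm_zero _ _ hC e1
    rw [cv, hc.dual hC (by omega) (by omega)] at e2
    have e3 : Xr N d i * Rᵀ = 0 := by
      rw [hRdef, hPM, Matrix.transpose_sub, Matrix.transpose_add,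
        Matrix.transpose_mul, Matrix.transpose_mul, Matrix.mul_sub, Matrix.mul_add,
        ← Matrix.mul_assoc, ← Matrix.mul_assoc, Xr_mul_XrT hk, Xr_mul_XrT (by omega),
        Xr_mul_XrT (by omega), if_neg (by omega), if_neg (by omega), if_neg (by omega)]
      simp
    rw [Matrix.transpose_sub, Matrix.mul_sub, e3, zero_sub, neg_eq_zero] at e2
    have := congrArg Matrix.transpose e2
    simpa [Matrix.transpose_mul] using this
  have huT : u * tmask N d ({j} ∪ {k₁}) = u := by
    ext a p
    rw [mul_tmask_apply]
    split_ifs with hp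
    · rfl
    · have h1 := congrFun (congrFun hu a) p
      change (u * tmask N d (Set.Icc k₁ j ∪ {k₁})) a p = u a p at h1
      rw [mul_tmask_apply] at h1
      split_ifs at h1 with hp'
      · have hpN := hSN _ hp'
        simp only [Set.mem_union, Set.mem_singleton_iff, Set.mem_Icc, not_or] at hp hp'
        have h2 := congrFun (congrFun (hint p.1 (by omega) (by omega)) a) p.2
        rw [mul_XrT hpN] at h2
        exact h2.symm
      · exact h1
  have huo : u * C * tmask N d ({j} ∪ {k₁}) = 0 := by
    rw [orth_iff hTN]
    intro i hi
    have h1 := hRT i hi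
    have h2 := huS i (by
      rcases hi with hi | hi
      · rw [Set.mem_singleton_iff] at hi
        exact Or.inl ⟨by omega, by omega⟩
      · exact Or.inr hi)
    rw [Matrix.sub_mul, Matrix.sub_mul, h1, zero_sub, neg_eq_zero] at h2
    exact h2
  have hq : u * C * uᵀ = 0 := by
    have : uᵀ = tmask N d ({j} ∪ {k₁}) * uᵀ := by
      conv_lhs => rw [← huT]
      rw [Matrix.transpose_mul, tmask, dmask_tr]
    rw [this, ← Matrix.mul_assoc, huo, Matrix.zero_mul]
  funext a
  by_contra hne
  have hp := hC.dotProduct_mulVec_pos hne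
  have := congrFun (congrFun hq a) a
  rw [Matrix.mul_assoc] at this
  simp only [star_trivial] at hp
  have e : (u * (C * uᵀ)) a a = u a ⬝ᵥ C *ᵥ u a := by
    simp [Matrix.mul_apply, dotProduct, mulVec]
  rw [e] at this
  simp only [Matrix.zero_apply] at this
  linarith

end Alg

section Final

variable {N d : ℕ} {C : Matrix (Fin (N + 1) × Fin d) (Fin (N + 1) × Fin d) ℝ}
  {Gm GN Gcov : ℕ → Mat d} {μ : Measure Ω} {x : ℕ → Ω → Fin d → ℝ}

lemma Xr_stack {k : ℕ} (hk : k ≤ N) (ω : Ω) : Xr N d k *ᵥ stack N d x ω = x k ω := by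
  ext a
  rw [Xr_mulVec hk]
  rfl

lemma Er_stack_mid {k : ℕ} (h1 : 1 ≤ k) (h2 : k < N) (ω : Ω) :
    Er N d Gm GN k *ᵥ stack N d x ω =
      x k ω - (Gm k *ᵥ x (k - 1) ω + GN k *ᵥ x N ω) := by
  rw [Er_mid h1 h2, Matrix.sub_mulVec, Matrix.add_mulVec, ← Matrix.mulVec_mulVec,
    ← Matrix.mulVec_mulVec, Xr_stack h2.le, Xr_stack (by omega), Xr_stack le_rfl]

lemma Er_stack_zero (hN : 0 < N) (ω : Ω) :
    Er N d Gm GN 0 *ᵥ stack N d x ω = x 0 ω - GN 0 *ᵥ x N ω := by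
  rw [Er_zero hN, Matrix.sub_mulVec, ← Matrix.mulVec_mulVec, Xr_stack (by omega),
    Xr_stack le_rfl]

lemma Er_stack_N (ω : Ω) : Er N d Gm GN N *ᵥ stack N d x ω = x N ω := by
  rw [Er_N, Xr_stack le_rfl]

lemma cv_apply {α β : Type*} (U : Matrix α (Fin (N + 1) × Fin d) ℝ)
    (V : Matrix β (Fin (N + 1) × Fin d) ℝ) (a : α) (b : β) :
    cv C U V a b = U a ⬝ᵥ C *ᵥ V b := by
  rw [cv, Matrix.mul_assoc, Matrix.mul_apply]
  rfl

lemma Lf_row {α : Type*} (U : Matrix α (Fin (N + 1) × Fin d) ℝ) (a : α) (ω : Ω) :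
    Lf (stack N d x) (U a) ω = (U *ᵥ stack N d x ω) a := rfl

lemma cov_congr_ae {X X' Y Y' : Ω → ℝ} (h : X =ᵐ[μ] X') (h' : Y =ᵐ[μ] Y') :
    cov[X, Y; μ] = cov[X', Y'; μ] := by
  unfold covariance
  rw [integral_congr_ae h, integral_congr_ae h']
  refine integral_congr_ae ?_
  filter_upwards [h, h'] with ω h1 h2
  rw [h1, h2]

lemma model_core [IsProbabilityMeasure μ] (hN : 0 < N) (hx : ZMNG N d μ x C)
    (h : CMLModel N d μ x Gm GN Gcov) : Core N d C Gm GN Gcov := by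
  classical
  obtain ⟨e, he, hpos, hae⟩ := h
  have key : ∀ᵐ ω ∂μ, ∀ k ≤ N, Er N d Gm GN k *ᵥ stack N d x ω = e k ω := by
    filter_upwards [hae] with ω hω k hk
    obtain ⟨h1, h2, h3⟩ := hω
    rcases hk.eq_or_lt with rfl | hk
    · rw [Er_stack_N, h2]
    · rcases Nat.eq_zero_or_pos k with rfl | hp
      · rw [Er_stack_zero hN]
        conv_lhs => rw [h3]
        simp
      · rw [Er_stack_mid hp hk]
        conv_lhs => rw [h1 k hp (by omega)]
        simp
  have hcov : ∀ i j, i ≤ N → j ≤ N → ∀ a b, cv C (Er N d Gm GN i) (Er N d Gm GN j) a b =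
      if i = j then Gcov i a b else 0 := by
    intro i j hi hj a b
    rw [cv_apply, ← Lf_cov (stack_meas hx.1) hx.2.1 hx.2.2.posSemidef]
    have hL : ∀ k (hk : k ≤ N) (a : Fin d), Lf (stack N d x) (Er N d Gm GN k a) =ᵐ[μ]
        Lf (stack N d e) (Pi.single (⟨k, by omega⟩, a) 1) := by
      intro k hk a
      filter_upwards [key] with ω hω
      rw [Lf_row, hω k hk]
      simp [Lf, Pi.single_apply, stack]
    rw [cov_congr_ae (hL i hi a) (hL j hj b),
      Lf_cov (stack_meas he.1) he.2.1 he.2.2.posSemidef]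
    simp [blockDiag]
  refine Core.of_uncorr hN ?_ ?_ hpos
  · intro i j hi hj hij
    ext a b
    rw [hcov i j hi hj, if_neg hij]
    rfl
  · intro k hk
    ext a b
    rw [hcov k k hk hk, if_pos rfl]

/-- Stacked noise coefficient matrix. -/
def Emat (N d : ℕ) (Gm GN : ℕ → Mat d) :
    Matrix (Fin (N + 1) × Fin d) (Fin (N + 1) × Fin d) ℝ :=
  fun p => Er N d Gm GN p.1 p.2

lemma Emat_cov (hC : C.PosDef) (hN : 0 < N) (hc : Core N d C Gm GN Gcov) :
    cv C (Emat N d Gm GN) (Emat N d Gm GN) = blockDiag N d Gcov := by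
  ext ⟨i, a⟩ ⟨j, b⟩
  have hi := i.isLt
  have hj := j.isLt
  rw [cv_apply]
  change Er N d Gm GN i a ⬝ᵥ C *ᵥ Er N d Gm GN j b = _
  rw [← cv_apply]
  simp only [blockDiag]
  split_ifs with h
  · rw [← h, hc.cov i (by omega)]
  · rw [hc.uncorr hC hN (by omega) (by omega) h]
    rfl

lemma blockDiag_posDef (hpos : ∀ k ≤ N, (Gcov k).PosDef) : (blockDiag N d Gcov).PosDef := by
  have hquad : ∀ v : Fin (N + 1) × Fin d → ℝ, v ⬝ᵥ blockDiag N d Gcov *ᵥ v =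
      ∑ i : Fin (N + 1), (fun a => v (i, a)) ⬝ᵥ Gcov i *ᵥ (fun a => v (i, a)) := by
    intro v
    rw [dotProduct, Fintype.sum_prod_type]
    refine Finset.sum_congr rfl fun i _ => ?_
    rw [dotProduct]
    refine Finset.sum_congr rfl fun a _ => ?_
    congr 1
    rw [mulVec, dotProduct, Fintype.sum_prod_type, Finset.sum_eq_single i]
    · simp [blockDiag, mulVec, dotProduct]
    · intro j _ hj
      have : (i : ℕ) ≠ j := fun h => hj (Fin.ext h.symm)
      simp [blockDiag, this]
    · simp
  refine Matrix.PosDef.of_dotProduct_mulVec_pos ?_ ?_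
  · ext ⟨i, a⟩ ⟨j, b⟩
    simp only [blockDiag, Matrix.conjTranspose_apply, star_trivial]
    by_cases h : (i : ℕ) = j
    · have := congrFun (congrFun (hpos i (by omega)).isHermitian.eq a) b
      simp only [Matrix.conjTranspose_apply, star_trivial] at this
      simp [← h, this]
    · simp [h, Ne.symm h]
  · intro v hv
    rw [star_trivial, hquad]
    have hnn : ∀ i : Fin (N + 1),
        0 ≤ (fun a => v (i, a)) ⬝ᵥ Gcov i *ᵥ (fun a => v (i, a)) := by
      intro i
      simpa using (hpos i (by omega)).posSemidef.dotProduct_mulVec_nonneg (fun a => v (i, a))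
    obtain ⟨p, hp⟩ := Function.ne_iff.1 hv
    refine Finset.sum_pos' (fun i _ => hnn i) ⟨p.1, Finset.mem_univ _, ?_⟩
    have hne : (fun a => v (p.1, a)) ≠ 0 := fun h => hp (congrFun h p.2)
    simpa using (hpos p.1 (by omega)).dotProduct_mulVec_pos hne

lemma core_model [IsProbabilityMeasure μ] (hN : 0 < N) (hx : ZMNG N d μ x C)
    (hc : Core N d C Gm GN Gcov) : CMLModel N d μ x Gm GN Gcov := by
  have hst : ∀ ω, stack N d (fun k ω => Er N d Gm GN k *ᵥ stack N d x ω) ω =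
      Emat N d Gm GN *ᵥ stack N d x ω := fun ω => rfl
  refine ⟨fun k ω => Er N d Gm GN k *ᵥ stack N d x ω, ⟨?_, ?_, blockDiag_posDef hc.pos⟩, hc.pos,
    Filter.Eventually.of_forall fun ω => ⟨?_, ?_, ?_⟩⟩
  · intro k _
    refine measurable_pi_lambda _ fun a => ?_
    exact Lf_measurable (stack_meas hx.1) (Er N d Gm GN k a)
  · intro l
    have h := hx.2.1 (l ᵥ* Emat N d Gm GN)
    have e1 : (fun ω => ∑ i, (l ᵥ* Emat N d Gm GN) i * stack N d x ω i) = fun ω =>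
        ∑ i, l i * stack N d (fun k ω => Er N d Gm GN k *ᵥ stack N d x ω) ω i := by
      ext ω
      rw [hst]
      change (l ᵥ* Emat N d Gm GN) ⬝ᵥ stack N d x ω = l ⬝ᵥ (Emat N d Gm GN *ᵥ stack N d x ω)
      rw [Matrix.dotProduct_mulVec]
    have e2 : (l ᵥ* Emat N d Gm GN) ⬝ᵥ C *ᵥ (l ᵥ* Emat N d Gm GN) =
        l ⬝ᵥ blockDiag N d Gcov *ᵥ l := by
      rw [← Emat_cov hx.2.2 hN hc, cv, ← Matrix.mulVec_mulVec, ← Matrix.mulVec_mulVec,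
        Matrix.mulVec_transpose, Matrix.dotProduct_mulVec l]
    rw [e1, e2] at h
    exact h
  · intro k h1 h2
    simp only
    rw [Er_stack_mid h1 (by omega)]
    abel
  · simp only
    rw [Er_stack_N]
  · simp only
    rw [Er_stack_zero hN]
    abel

lemma Er_left_inv {k : ℕ} (hN : 0 < N) (hk : k ≤ N) :
    Er N d Gm GN k * (Xr N d k)ᵀ = 1 := by
  rcases hk.eq_or_lt with rfl | hk'
  · rw [Er_N, Xr_mul_XrT le_rfl, if_pos rfl]
  · rcases Nat.eq_zero_or_pos k with rfl | hp
    · rw [Er_zero hN, Matrix.sub_mul, Matrix.mul_assoc, Xr_mul_XrT hk, Xr_mul_XrT hk, if_pos rfl,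
        if_neg (by omega)]
      simp
    · rw [Er_mid hp hk', Matrix.sub_mul, Matrix.add_mul, Matrix.mul_assoc, Matrix.mul_assoc,
        Xr_mul_XrT hk, Xr_mul_XrT hk, Xr_mul_XrT hk, if_pos rfl, if_neg (by omega),
        if_neg (by omega)]
      simp

lemma cml_core [IsProbabilityMeasure μ] (hN : 0 < N) (hx : ZMNG N d μ x C)
    (h : IsCM μ x 0 N N) : ∃ Gm GN Gcov : ℕ → Mat d, Core N d C Gm GN Gcov := by
  have hC := hx.2.2
  have hmid : ∀ k, ∃ M₁ M₂ : Mat d, 1 ≤ k → k < N → ∀ i, (i < k ∨ i = N) →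
      cv C (Xr N d k - (M₁ * Xr N d (k - 1) + M₂ * Xr N d N)) (Xr N d i) = 0 := by
    intro k
    by_cases hk : 1 ≤ k ∧ k < N
    · obtain ⟨h1, h2⟩ := hk
      obtain ⟨M₁, M₂, hM⟩ := (condEq_iff hx h2.le (S := Set.Icc 0 (k - 1) ∪ {N}) (by
        rintro i (hi | hi)
        · have := hi.2; omega
        · exact le_of_eq hi) (Or.inl ⟨by omega, le_rfl⟩) (Or.inr rfl)).1
        (h (k - 1) k (by omega) (by omega) h2.le)
      refine ⟨M₁, M₂, fun _ _ i hi => hM i ?_⟩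
      rcases hi with hi | hi
      · exact Or.inl ⟨by omega, by omega⟩
      · exact Or.inr hi
    · exact ⟨0, 0, fun a b => absurd ⟨a, b⟩ hk⟩
  choose Gm GN' hG using hmid
  have hNN : (cv C (Xr N d N) (Xr N d N)).PosDef := cv_posDef _ hC ⟨(Xr N d N)ᵀ, by
    rw [Xr_mul_XrT le_rfl, if_pos rfl]⟩
  let GN : ℕ → Mat d := fun k => if k = 0 then
    cv C (Xr N d 0) (Xr N d N) * (cv C (Xr N d N) (Xr N d N))⁻¹ else GN' k
  refine ⟨Gm, GN, fun k => cv C (Er N d Gm GN k) (Er N d Gm GN k), ?_, fun _ _ => rfl, ?_⟩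
  · intro k hk i hi
    rcases Nat.eq_zero_or_pos k with rfl | hp
    · have hi : i = N := by omega
      subst hi
      rw [Er_zero hN, cv_sub_left, cv_mul_left]
      simp only [GN, if_true]
      rw [Matrix.mul_assoc, posDef_inv_mul hNN]
      simp
    · rw [Er_mid hp hk]
      have : GN k = GN' k := if_neg (by omega)
      rw [this]
      exact hG k hp hk i hi
  · intro k hk
    exact cv_posDef _ hC ⟨(Xr N d k)ᵀ, Er_left_inv hN hk⟩

end Final

/-- For `k₁ ∈ [0,N]`: a zero-mean nonsingular Gaussian sequence
`[x_k]`, `k ∈ [0,N]`, is both CM_L and `[k₁,N]`-CM_F iff it obeys a CM_L model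
whose parameters satisfy `G_k⁻¹ G_{k,N} = G_{k+1,k}' G_{k+1}⁻¹ G_{k+1,N}` for all
`k ∈ [k₁+1, N-2]`. -/
theorem stmt12 {N d : ℕ} (hN : 3 ≤ N) (hd : 1 ≤ d)
    (μ : Measure Ω) [IsProbabilityMeasure μ] (x : ℕ → Ω → Fin d → ℝ)
    (C : Matrix (Fin (N + 1) × Fin d) (Fin (N + 1) × Fin d) ℝ)
    (hx : ZMNG N d μ x C) (k₁ : ℕ) (hk₁ : k₁ ≤ N) :
    (IsCM μ x 0 N N ∧ IsCM μ x k₁ N k₁) ↔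
      ∃ Gm GN Gcov : ℕ → Mat d,
        CMLModel N d μ x Gm GN Gcov ∧
        ∀ k, k₁ + 1 ≤ k → k ≤ N - 2 →
          (Gcov k)⁻¹ * GN k = (Gm (k + 1))ᵀ * (Gcov (k + 1))⁻¹ * GN (k + 1) := by
  have hC := hx.2.2
  have hN0 : 0 < N := by omega
  constructor
  · rintro ⟨hL, hF⟩
    obtain ⟨Gm, GN, Gcov, hc⟩ := cml_core hN0 hx hL
    refine ⟨Gm, GN, Gcov, core_model hN0 hx hc, fun k h1 h2 => ?_⟩
    obtain ⟨M₁, M₂, hM⟩ := (condEq_iff hx le_rfl (S := Set.Icc k₁ (N - 1) ∪ {k₁}) (by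
      rintro i (hi | hi)
      · have := hi.2; omega
      · exact (le_of_eq hi).trans hk₁) (Or.inl ⟨by omega, le_rfl⟩) (Or.inr rfl)).1
      (hF (N - 1) N (by omega) (by omega) le_rfl)
    exact hc.cond_of_cmf hC h1 (by omega) M₁ M₂ hM
  · rintro ⟨Gm, GN, Gcov, hmod, hcond⟩
    have hc := model_core hN0 hx hmod
    constructor
    · intro j k hj hjk hk
      refine (condEq_iff hx hk (by
        rintro i (hi | hi)
        · have := hi.2; omega
        · exact le_of_eq hi) (Or.inl ⟨hj, le_rfl⟩) (Or.inr rfl)).2 ?_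
      exact hc.cml j k hjk hk
    · intro j k hj hjk hk
      refine (condEq_iff hx hk (by
        rintro i (hi | hi)
        · have := hi.2; omega
        · exact (le_of_eq hi).trans hk₁) (Or.inl ⟨hj, le_rfl⟩) (Or.inr rfl)).2 ?_
      exact hc.cmf_of_cond hC hj hjk hk hcond

end CMSeqPaper
end

section
/- Let k_2 ∈ [1,N−1]. A zero-mean nonsingular Gaussian sequence [x_k], k ∈ [0,N], is both CM_L and [0,k_2]-CM_L if and only if there exist d×d matrices and zero-mean jointly Gaussian, mutually uncorrelated random vectors e_k with positive definite covariances G_k = Cov(e_k) such that: x_k = G_{k,k−1} x_{k−1} + G_{k,k_2} x_{k_2} + e_k for k ∈ [1,k_2−1]; x_{k_2} = e_{k_2}; x_0 = G_{0,k_2} x_{k_2} + e_0; x_N = Σ_{i=0}^{k_2} G_{N,i} x_i + e_N; x_k = G_{k,k−1} x_{k−1} + G_{k,N} x_N + e_k for k ∈ [k_2+1,N−1]; and the parameters satisfy G_{N,j}' G_N⁻¹ G_{N,i} = 0 for all j ∈ {0,…,k_2−3} and i ∈ {j+2,…,k_2−1}, and G_l⁻¹ G_{l,k_2} = G_{l+1,l}'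 G_{l+1}⁻¹ G_{l+1,k_2} + G_{N,l}' G_N⁻¹ G_{N,k_2} for all l ∈ {0,…,k_2−2}. -/
open MeasureTheory ProbabilityTheory Matrix
open scoped NNReal

namespace CMSeqPaper

variable {Ω : Type*} [MeasurableSpace Ω]

set_option linter.unusedSectionVars false
set_option linter.unusedVariables false

/-! ### Gaussian preliminaries -/

noncomputable def lin {ι : Type*} [Fintype ι] (X : Ω → ι → ℝ) (l : ι → ℝ) (ω : Ω) : ℝ := ∑ i, l i * X ω i

section Gauss

variable {ι : Type*} [Fintype ι] {μ : Measure Ω} [IsProbabilityMeasure μ]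
  {X : Ω → ι → ℝ} {C : Matrix ι ι ℝ}

lemma gauss_map (h : IsZeroMeanGaussian μ X C) (l : ι → ℝ) :
    μ.map (lin X l) = gaussianReal 0 (l ⬝ᵥ C.mulVec l).toNNReal := h l

lemma measurable_lin (hX : Measurable X) (l : ι → ℝ) : Measurable (lin X l) := by
  unfold lin
  refine Finset.measurable_sum _ fun i _ => ?_
  exact measurable_const.mul ((measurable_pi_apply i).comp hX)

lemma gauss_law_s13 (hX : Measurable X) (h : IsZeroMeanGaussian μ X C) : HasGaussianLaw X μ where
  isGaussian_map := by
    refine isGaussian_of_map_eq_gaussianReal fun L => ?_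
    classical
    refine ⟨0, ((fun i => L (Pi.single i 1)) ⬝ᵥ C.mulVec (fun i => L (Pi.single i 1))).toNNReal, ?_⟩
    rw [Measure.map_map (by fun_prop) hX, ← h (fun i => L (Pi.single i 1))]
    congr 1
    funext ω
    simp only [Function.comp]
    conv_lhs => rw [show X ω = ∑ i, X ω i • (Pi.single i (1:ℝ) : ι → ℝ) by
      funext j; simp [Finset.sum_apply, Pi.single_apply]]
    rw [map_sum]
    refine Finset.sum_congr rfl fun i _ => ?_
    rw [map_smul, smul_eq_mul, mul_comm]

/-- The continuous linear map with rows `L a`. -/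
noncomputable def rowsCLM {α : Type*} [Fintype α] (L : α → ι → ℝ) : (ι → ℝ) →L[ℝ] (α → ℝ) :=
  LinearMap.toContinuousLinearMap (Matrix.mulVecLin (Matrix.of L))

lemma rowsCLM_apply {α : Type*} [Fintype α] (L : α → ι → ℝ) (ω : Ω) (a : α) :
    rowsCLM L (X ω) a = lin X (L a) ω := by
  simp [rowsCLM, lin, Matrix.mulVec, dotProduct]

lemma gauss_lin (hX : Measurable X) (h : IsZeroMeanGaussian μ X C) (l : ι → ℝ) :
    HasGaussianLaw (lin X l) μ where
  isGaussian_map := by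
    rw [gauss_map h l]; infer_instance

lemma gauss_memLp (hX : Measurable X) (h : IsZeroMeanGaussian μ X C) (l : ι → ℝ) :
    MemLp (lin X l) 2 μ := (gauss_lin hX h l).memLp_two

lemma gauss_mean (hX : Measurable X) (h : IsZeroMeanGaussian μ X C) (l : ι → ℝ) :
    ∫ ω, lin X l ω ∂μ = 0 := by
  have := integral_map (μ := μ) (measurable_lin hX l).aemeasurable
    (f := fun y : ℝ => y) (by fun_prop)
  rw [gauss_map h l] at this
  rw [← this, integral_id_gaussianReal]

lemma gauss_var (hX : Measurable X) (h : IsZeroMeanGaussian μ X C) (hC : C.PosSemidef)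
    (l : ι → ℝ) : Var[lin X l; μ] = l ⬝ᵥ C.mulVec l := by
  have := variance_map (μ := μ) (X := fun y : ℝ => y) (Y := lin X l) (by fun_prop)
    (measurable_lin hX l).aemeasurable
  rw [gauss_map h l, variance_fun_id_gaussianReal] at this
  have h0 : 0 ≤ l ⬝ᵥ C.mulVec l := by simpa using hC.dotProduct_mulVec_nonneg l
  rw [Real.coe_toNNReal _ h0] at this
  exact this.symm

lemma lin_add (l m : ι → ℝ) : lin X (l + m) = lin X l + lin X m := by
  funext ω; simp [lin, add_mul, Finset.sum_add_distrib]

lemma lin_sub (l m : ι → ℝ) : lin X (l - m) = lin X l - lin X m := by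
  funext ω; simp [lin, sub_mul, Finset.sum_sub_distrib]

lemma bil_comm (hC : C.PosSemidef) (l m : ι → ℝ) : l ⬝ᵥ C.mulVec m = m ⬝ᵥ C.mulVec l := by
  have hs : Cᵀ = C := by simpa [Matrix.IsHermitian] using hC.1
  rw [dotProduct_comm, ← Matrix.vecMul_transpose, hs, ← Matrix.dotProduct_mulVec]

lemma gauss_cov (hX : Measurable X) (h : IsZeroMeanGaussian μ X C) (hC : C.PosSemidef)
    (l m : ι → ℝ) : cov[lin X l, lin X m; μ] = l ⬝ᵥ C.mulVec m := by
  have := variance_add (gauss_memLp hX h l) (gauss_memLp hX h m)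
  rw [← lin_add, gauss_var hX h hC, gauss_var hX h hC, gauss_var hX h hC, mulVec_add,
    add_dotProduct, dotProduct_add, dotProduct_add, bil_comm hC m l] at this
  linarith

lemma gauss_indep (hX : Measurable X) (h : IsZeroMeanGaussian μ X C) (hC : C.PosSemidef)
    {α β : Type*} [Fintype α] [Fintype β] (L : α → ι → ℝ) (M : β → ι → ℝ)
    (h0 : ∀ a b, L a ⬝ᵥ C.mulVec (M b) = 0) :
    IndepFun (fun ω a => lin X (L a) ω) (fun ω b => lin X (M b) ω) μ := by
  refine HasGaussianLaw.indepFun_of_covariance_eval ?_ ?_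
  · have := (gauss_law_s13 hX h).map ((rowsCLM L).prod (rowsCLM M))
    refine this.congr (Filter.Eventually.of_forall fun ω => ?_)
    simp only [Function.comp, ContinuousLinearMap.prod_apply]
    ext a <;> exact rowsCLM_apply ..
  · intro a b
    rw [gauss_cov hX h hC, h0]

/-- Linear projection onto a finite family of vectors, in the `C` inner product. -/
lemma cov_unique {C' : Matrix ι ι ℝ} (hC : C.PosSemidef) (hC' : C'.PosSemidef)
    (h : IsZeroMeanGaussian μ X C) (h' : IsZeroMeanGaussian μ X C') : C = C' := by
  have hq : ∀ l, l ⬝ᵥ C.mulVec l = l ⬝ᵥ C'.mulVec l := by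
    intro l
    have h0 : 0 ≤ l ⬝ᵥ C.mulVec l := by simpa using hC.dotProduct_mulVec_nonneg l
    have h0' : 0 ≤ l ⬝ᵥ C'.mulVec l := by simpa using hC'.dotProduct_mulVec_nonneg l
    have := (h l).symm.trans (h' l)
    have := congrArg (fun ν => Var[fun y : ℝ => y; ν]) this
    simp only [variance_fun_id_gaussianReal] at this
    rwa [Real.coe_toNNReal _ h0, Real.coe_toNNReal _ h0'] at this
  have hb : ∀ l m, l ⬝ᵥ C.mulVec m = l ⬝ᵥ C'.mulVec m := by
    intro l m
    have := hq (l + m)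
    simp only [mulVec_add, add_dotProduct, dotProduct_add, bil_comm hC m l, bil_comm hC' m l] at this
    linarith [hq l, hq m]
  classical
  ext i j
  simpa using hb (Pi.single i 1) (Pi.single j 1)

end Gauss

/-! ### Conditional distributions versus linear projections -/

section Cond

variable {μ : Measure Ω} [IsProbabilityMeasure μ] {d : ℕ}

lemma condExp_shift {β : Type*} [mβ : MeasurableSpace β] {Y : Ω → β} (hY : Measurable Y)
    {r : Ω → Fin d → ℝ} (hr : Measurable r) (hind : IndepFun Y r μ)
    {hh : β → Fin d → ℝ} (hhm : Measurable hh) {A : Set (Fin d → ℝ)} (hA : MeasurableSet A) :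
    μ[fun ω => A.indicator (fun _ => (1 : ℝ)) (r ω + hh (Y ω)) | mβ.comap Y] =ᵐ[μ]
      fun ω => ∫ z, A.indicator (fun _ => (1 : ℝ)) (z + hh (Y ω)) ∂(μ.map r) := by
  have hm : Measurable (fun p : β × (Fin d → ℝ) =>
      A.indicator (fun _ => (1 : ℝ)) (p.2 + hh p.1)) := by
    refine (measurable_const.indicator hA).comp ?_
    exact measurable_snd.add (hhm.comp measurable_fst)
  have h1 := condExp_prod_ae_eq_integral_condDistrib (μ := μ) (X := Y) (Y := r) hY hr.aemeasurable
    (f := fun p : β × (Fin d → ℝ) => A.indicator (fun _ => (1 : ℝ)) (p.2 + hh p.1))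
    hm.stronglyMeasurable ?_
  · have : IsProbabilityMeasure (μ.map r) := Measure.isProbabilityMeasure_map hr.aemeasurable
    have h2 : condDistrib r Y μ =ᵐ[μ.map Y] Kernel.const β (μ.map r) := by
      refine condDistrib_ae_eq_of_measure_eq_compProd Y hr.aemeasurable ?_
      rw [Measure.compProd_const]
      exact (indepFun_iff_map_prod_eq_prod_map_map hY.aemeasurable hr.aemeasurable).1 hind
    have h3 := ae_of_ae_map hY.aemeasurable h2
    filter_upwards [h1, h3] with ω h h'
    rw [h, h']
    simp
  · refine Integrable.of_bound (C := 1)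
      (hm.comp (hY.prodMk hr)).aestronglyMeasurable (Filter.Eventually.of_forall fun ω => ?_)
    by_cases hω : r ω + hh (Y ω) ∈ A <;> simp [hω]

end Cond

lemma condEq_integrable {Ω : Type*} {d : ℕ} {m₁ m₂ mΩ : MeasurableSpace Ω} {μ : Measure Ω}
    [IsProbabilityMeasure μ] {y : Ω → Fin d → ℝ} (hy : Measurable y)
    (h : ∀ A : Set (Fin d → ℝ), MeasurableSet A →
      μ[A.indicator (fun _ => (1 : ℝ)) ∘ y | m₁] =ᵐ[μ] μ[A.indicator (fun _ => (1 : ℝ)) ∘ y | m₂])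
    {f : (Fin d → ℝ) → ℝ} (hf : Integrable (f ∘ y) μ) (hfm : Measurable f) :
    μ[f ∘ y | m₁] =ᵐ[μ] μ[f ∘ y | m₂] := by
  have hfi : Integrable f (μ.map y) :=
    (integrable_map_measure hfm.aestronglyMeasurable hy.aemeasurable).2 hf
  have hsimp : ∀ g : SimpleFunc (Fin d → ℝ) ℝ, μ[g ∘ y | m₁] =ᵐ[μ] μ[g ∘ y | m₂] := by
    intro g
    have hint : ∀ g : SimpleFunc (Fin d → ℝ) ℝ, Integrable (g ∘ y) μ := fun g => by
      obtain ⟨c, hc⟩ := g.exists_forall_norm_le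
      exact Integrable.of_bound (C := c) (g.measurable.comp hy).aestronglyMeasurable
        (Filter.Eventually.of_forall fun ω => hc _)
    induction g using SimpleFunc.induction with
    | const c hs =>
      rename_i s
      have e : (SimpleFunc.piecewise s hs (SimpleFunc.const _ c) (SimpleFunc.const _ 0) : _ → ℝ) ∘ y
          = c • (s.indicator (fun _ => (1:ℝ)) ∘ y) := by
        funext ω
        simp only [SimpleFunc.coe_piecewise, Function.comp, Set.piecewise, Pi.smul_apply,
          SimpleFunc.coe_const, Function.const]
        by_cases hω : y ω ∈ s <;> simp [hω]
      rw [e]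
      filter_upwards [h s hs, condExp_smul (μ := μ) c (s.indicator (fun _ => (1:ℝ)) ∘ y) m₁,
        condExp_smul (μ := μ) c (s.indicator (fun _ => (1:ℝ)) ∘ y) m₂] with ω a b e
      rw [b, e]; simp [a]
    | @add f g hfg hf hg =>
      have e : (⇑(f + g)) ∘ y = (f ∘ y) + (g ∘ y) := by
        funext ω; simp
      rw [e]
      filter_upwards [hf, hg, condExp_add (hint f) (hint g) m₁,
        condExp_add (hint f) (hint g) m₂] with ω a b e e'
      rw [e, e']; simp [a, b]
  have hzero : eLpNorm (μ[f ∘ y | m₁] - μ[f ∘ y | m₂]) 1 μ = 0 := by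
    by_contra hne
    have hpos : 0 < eLpNorm (μ[f ∘ y | m₁] - μ[f ∘ y | m₂]) 1 μ := pos_iff_ne_zero.2 hne
    obtain ⟨g, hg, hgm⟩ := (memLp_one_iff_integrable.2 hfi).exists_simpleFunc_eLpNorm_sub_lt
      (by simp) (ε := eLpNorm (μ[f ∘ y | m₁] - μ[f ∘ y | m₂]) 1 μ / 2)
      (by simpa using hne)
    have hgi : Integrable (g ∘ y) μ :=
      (integrable_map_measure g.measurable.aestronglyMeasurable hy.aemeasurable).1
        (memLp_one_iff_integrable.1 hgm)
    have hn : eLpNorm (f ∘ y - g ∘ y) 1 μ < eLpNorm (μ[f ∘ y | m₁] - μ[f ∘ y | m₂]) 1 μ / 2 := by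
      rwa [eLpNorm_map_measure (hfm.sub g.measurable).aestronglyMeasurable hy.aemeasurable] at hg
    have key : μ[f ∘ y | m₁] - μ[f ∘ y | m₂] =ᵐ[μ]
        μ[f ∘ y - g ∘ y | m₁] - μ[f ∘ y - g ∘ y | m₂] := by
      filter_upwards [condExp_sub hf hgi m₁, condExp_sub hf hgi m₂, hsimp g] with ω a b e
      simp [a, b, e]
    have : eLpNorm (μ[f ∘ y | m₁] - μ[f ∘ y | m₂]) 1 μ ≤
        eLpNorm (f ∘ y - g ∘ y) 1 μ + eLpNorm (f ∘ y - g ∘ y) 1 μ := by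
      rw [eLpNorm_congr_ae key]
      refine (eLpNorm_sub_le integrable_condExp.aestronglyMeasurable
        integrable_condExp.aestronglyMeasurable le_rfl).trans ?_
      exact add_le_add (eLpNorm_one_condExp_le_eLpNorm _) (eLpNorm_one_condExp_le_eLpNorm _)
    have h2 := this.trans_lt (ENNReal.add_lt_add hn hn)
    rw [ENNReal.add_halves] at h2
    exact lt_irrefl _ h2
  have := (eLpNorm_eq_zero_iff
    (integrable_condExp.aestronglyMeasurable.sub integrable_condExp.aestronglyMeasurable)
    one_ne_zero).1 hzero
  filter_upwards [this] with ω h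
  simpa [sub_eq_zero] using h

section Proj

variable {N d : ℕ}

/-- `v` vanishes outside the blocks in `S`. -/
def Supp (v : Fin (N + 1) × Fin d → ℝ) (S : Set ℕ) : Prop := ∀ p, (p.1 : ℕ) ∉ S → v p = 0

/-- The `C`-projection of `v` on blocks `S` is supported on blocks `T`. -/
def LinEq (C : Matrix (Fin (N + 1) × Fin d) (Fin (N + 1) × Fin d) ℝ)
    (v : Fin (N + 1) × Fin d → ℝ) (S T : Set ℕ) : Prop :=
  ∃ w, Supp w T ∧ ∀ u, Supp u S → (v - w) ⬝ᵥ C.mulVec u = 0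

lemma Supp.mono {v : Fin (N + 1) × Fin d → ℝ} {S T : Set ℕ} (h : Supp v S) (hST : S ⊆ T) :
    Supp v T := fun p hp => h p fun h' => hp (hST h')

lemma Supp.add {v w : Fin (N + 1) × Fin d → ℝ} {S : Set ℕ} (h : Supp v S) (h' : Supp w S) :
    Supp (v + w) S := fun p hp => by simp [h p hp, h' p hp]

lemma Supp.sub {v w : Fin (N + 1) × Fin d → ℝ} {S : Set ℕ} (h : Supp v S) (h' : Supp w S) :
    Supp (v - w) S := fun p hp => by simp [h p hp, h' p hp]

lemma Supp.smul {v : Fin (N + 1) × Fin d → ℝ} {S : Set ℕ} (c : ℝ) (h : Supp v S) :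
    Supp (c • v) S := fun p hp => by simp [h p hp]

lemma supp_zero {S : Set ℕ} : Supp (0 : Fin (N + 1) × Fin d → ℝ) S := fun _ _ => rfl

lemma supp_single {S : Set ℕ} (p : Fin (N + 1) × Fin d) (hp : (p.1 : ℕ) ∈ S) (c : ℝ) :
    Supp (Pi.single p c : Fin (N + 1) × Fin d → ℝ) S := by
  intro q hq
  rw [Pi.single_apply, if_neg]
  rintro rfl
  exact hq hp

lemma linEq_self {C : Matrix (Fin (N + 1) × Fin d) (Fin (N + 1) × Fin d) ℝ} (hC : C.PosDef)
    (v : Fin (N + 1) × Fin d → ℝ) (S : Set ℕ) : LinEq C v S S := by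
  classical
  let σ := {p : Fin (N + 1) × Fin d // (p.1 : ℕ) ∈ S}
  let CS : Matrix σ σ ℝ := C.submatrix Subtype.val Subtype.val
  have hCS : CS.PosDef := hC.submatrix Subtype.val_injective
  let ws : σ → ℝ := CS⁻¹.mulVec (fun q => C.mulVec v q.1)
  have hws : CS.mulVec ws = fun q => C.mulVec v q.1 := by
    simp only [ws, mulVec_mulVec]
    rw [Matrix.mul_nonsing_inv _ ((Matrix.isUnit_iff_isUnit_det _).1 hCS.isUnit), one_mulVec]
  refine ⟨fun p => if h : (p.1 : ℕ) ∈ S then ws ⟨p, h⟩ else 0, fun p hp => by simp [hp], ?_⟩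
  intro u hu
  rw [bil_comm hC.posSemidef, dotProduct]
  refine Finset.sum_eq_zero fun q _ => ?_
  by_cases hq : (q.1 : ℕ) ∈ S
  · have h1 := congrFun hws ⟨q, hq⟩
    simp only at h1
    rw [mulVec_sub, Pi.sub_apply, ← h1]
    simp only [CS, mulVec, dotProduct, submatrix_apply]
    have : ∑ p : σ, C q p.1 * ws p = ∑ p : Fin (N + 1) × Fin d,
        C q p * (if h : (p.1 : ℕ) ∈ S then ws ⟨p, h⟩ else 0) := by
      rw [← Finset.sum_filter_of_ne (p := fun p : Fin (N + 1) × Fin d => (p.1 : ℕ) ∈ S)]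
      · rw [Finset.sum_subtype (p := fun p : Fin (N + 1) × Fin d => (p.1 : ℕ) ∈ S) _ (by simp)]
        refine Finset.sum_congr rfl fun p _ => ?_
        rw [dif_pos p.2]
      · intro p _ hp
        by_contra h
        simp [h] at hp
    rw [this]; ring
  · rw [hu q hq, zero_mul]

end Proj

section CondIff

variable {N d : ℕ} {μ : Measure Ω} [IsProbabilityMeasure μ] {x : ℕ → Ω → Fin d → ℝ}
  {C : Matrix (Fin (N + 1) × Fin d) (Fin (N + 1) × Fin d) ℝ}

/-- The states at the times in `S`, as a vector. -/
def subY (N d : ℕ) (x : ℕ → Ω → Fin d → ℝ) (S : Set ℕ) :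
    Ω → {p : Fin (N + 1) × Fin d // (p.1 : ℕ) ∈ S} → ℝ := fun ω p => stack N d x ω p.1

lemma sigmaOf_eq {S : Set ℕ} (hS : S ⊆ Set.Iic N) :
    sigmaOf x S = MeasurableSpace.comap (subY N d x S) inferInstance := by
  apply le_antisymm
  · refine iSup₂_le fun i hi => ?_
    rw [← measurable_iff_comap_le]
    refine @measurable_pi_lambda _ _ _ (MeasurableSpace.comap (subY N d x S) inferInstance) _ _
      fun a => ?_
    have hi' : i < N + 1 := Nat.lt_succ_of_le (hS hi)
    exact (measurable_pi_apply (⟨(⟨i, hi'⟩, a), hi⟩ :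
      {p : Fin (N + 1) × Fin d // (p.1 : ℕ) ∈ S})).comp (comap_measurable (subY N d x S))
  · rw [← measurable_iff_comap_le]
    refine @measurable_pi_lambda _ _ _ (sigmaOf x S) _ _ fun p => ?_
    have h1 : Measurable[MeasurableSpace.comap (x p.1.1) inferInstance] (x p.1.1) :=
      comap_measurable _
    have h2 : MeasurableSpace.comap (x p.1.1) inferInstance ≤ sigmaOf x S :=
      le_iSup₂_of_le (f := fun i (_ : i ∈ S) => MeasurableSpace.comap (x i) inferInstance)
        (p.1.1 : ℕ) p.2 le_rfl
    exact (measurable_pi_apply p.1.2).comp (h1.mono h2 le_rfl)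

lemma measurable_stack (hx : ZMNG N d μ x C) : Measurable (stack N d x) := by
  refine measurable_pi_lambda _ fun p => ?_
  exact (measurable_pi_apply p.2).comp (hx.1 p.1 (Nat.lt_succ_iff.1 p.1.2))

lemma measurable_subY (hx : ZMNG N d μ x C) (S : Set ℕ) : Measurable (subY N d x S) :=
  measurable_pi_lambda _ fun p => (measurable_pi_apply p.1).comp (measurable_stack hx)

lemma lin_single (p : Fin (N + 1) × Fin d) (ω : Ω) :
    lin (stack N d x) (Pi.single p 1) ω = stack N d x ω p := by
  simp [lin, Pi.single_apply]

open Classical in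
/-- Value of a supported functional from the states in `S`. -/
noncomputable def evalS (S : Set ℕ) (w : Fin (N + 1) × Fin d → ℝ)
    (y : {p : Fin (N + 1) × Fin d // (p.1 : ℕ) ∈ S} → ℝ) : ℝ := ∑ p, w p.1 * y p

lemma evalS_subY {S : Set ℕ} {w : Fin (N + 1) × Fin d → ℝ} (hw : Supp w S) (ω : Ω) :
    evalS S w (subY N d x S ω) = lin (stack N d x) w ω := by
  classical
  unfold evalS lin subY
  rw [← Finset.sum_filter_of_ne (s := Finset.univ)
    (p := fun p : Fin (N + 1) × Fin d => (p.1 : ℕ) ∈ S)]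
  · rw [Finset.sum_subtype (p := fun p : Fin (N + 1) × Fin d => (p.1 : ℕ) ∈ S) _ (by simp)]
  · intro p _ hp
    by_contra h
    simp [hw p h] at hp

lemma measurable_evalS (S : Set ℕ) (w : Fin (N + 1) × Fin d → ℝ) : Measurable (evalS S w) := by
  unfold evalS
  exact Finset.measurable_sum _ fun i _ => measurable_const.mul (measurable_pi_apply i)

lemma indep_resid (hx : ZMNG N d μ x C) {S : Set ℕ} {α : Type*} [Fintype α]
    (L : α → Fin (N + 1) × Fin d → ℝ) (hL : ∀ a u, Supp u S → L a ⬝ᵥ C.mulVec u = 0) :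
    IndepFun (subY N d x S) (fun ω a => lin (stack N d x) (L a) ω) μ := by
  classical
  have := gauss_indep (measurable_stack hx) hx.2.1 hx.2.2.posSemidef L
    (fun p : {p : Fin (N + 1) × Fin d // (p.1 : ℕ) ∈ S} => Pi.single p.1 1)
    (fun a p => hL a _ (supp_single p.1 p.2 1))
  refine this.symm.congr (Filter.Eventually.of_forall fun ω => ?_) Filter.EventuallyEq.rfl
  funext p
  exact lin_single p.1 ω

lemma condExp_lin_s13 (hx : ZMNG N d μ x C) {S : Set ℕ} (hS : S ⊆ Set.Iic N)
    {v w : Fin (N + 1) × Fin d → ℝ} (hw : Supp w S)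
    (h : ∀ u, Supp u S → (v - w) ⬝ᵥ C.mulVec u = 0) :
    μ[lin (stack N d x) v | sigmaOf x S] =ᵐ[μ] lin (stack N d x) w := by
  have hX := measurable_stack hx
  have hY := measurable_subY hx S
  have hle : sigmaOf x S ≤ ‹MeasurableSpace Ω› := by
    rw [sigmaOf_eq hS]; exact hY.comap_le
  have hi := indep_resid hx (S := S) (fun _ : Unit => v - w) (fun _ u hu => h u hu)
  have hi' : IndepFun (lin (stack N d x) (v - w)) (subY N d x S) μ :=
    (hi.comp measurable_id (measurable_pi_apply ())).symm
  have h0 : μ[lin (stack N d x) (v - w) | sigmaOf x S] =ᵐ[μ] fun _ => 0 := by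
    have := condExp_indep_eq (μ := μ) (m₁ := MeasurableSpace.comap (lin (stack N d x) (v - w)) inferInstance)
      (m₂ := sigmaOf x S) (f := lin (stack N d x) (v - w)) (measurable_lin hX _).comap_le hle
      (comap_measurable _).stronglyMeasurable (by rw [sigmaOf_eq hS]; exact hi')
    rwa [gauss_mean hX hx.2.1] at this
  have hint : ∀ l, Integrable (lin (stack N d x) l) μ := fun l =>
    (gauss_memLp hX hx.2.1 l).integrable (by norm_num)
  have hwm : StronglyMeasurable[sigmaOf x S] (lin (stack N d x) w) := by
    have : lin (stack N d x) w = evalS S w ∘ subY N d x S := by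
      funext ω; exact (evalS_subY hw ω).symm
    rw [this, sigmaOf_eq hS]
    exact ((measurable_evalS S w).comp (comap_measurable _)).stronglyMeasurable
  have e : lin (stack N d x) v = lin (stack N d x) (v - w) + lin (stack N d x) w := by
    rw [← lin_add]; simp
  rw [e]
  have h2 := condExp_of_stronglyMeasurable (μ := μ) hle hwm (hint w)
  filter_upwards [condExp_add (hint (v - w)) (hint w) (sigmaOf x S), h0] with ω a b
  rw [a, Pi.add_apply, b, h2, zero_add]

lemma condEq_iff_s13 (hx : ZMNG N d μ x C) (k : Fin (N + 1)) {S T : Set ℕ} (hTS : T ⊆ S)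
    (hS : S ⊆ Set.Iic N) :
    CondEq μ x k S T ↔ ∀ a, LinEq C (Pi.single (k, a) 1) S T := by
  have hX := measurable_stack hx
  have hT := hTS.trans hS
  have hle : ∀ {S}, S ⊆ Set.Iic N → sigmaOf x S ≤ ‹MeasurableSpace Ω› := fun hS => by
    rw [sigmaOf_eq hS]; exact (measurable_subY hx _).comap_le
  constructor
  · intro h a
    obtain ⟨wS, hwS, hS'⟩ := linEq_self hx.2.2 (Pi.single (k, a) 1) S
    obtain ⟨wT, hwT, hT'⟩ := linEq_self hx.2.2 (Pi.single (k, a) 1) T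
    have e : (fun y : Fin d → ℝ => y a) ∘ x k = lin (stack N d x) (Pi.single (k, a) 1) := by
      funext ω; rw [lin_single]; rfl
    have h1 := condEq_integrable (hx.1 k (Nat.lt_succ_iff.1 k.2)) h
      (f := fun y => y a) (by
        rw [e]; exact (gauss_memLp hX hx.2.1 _).integrable (by norm_num)) (measurable_pi_apply a)
    rw [e] at h1
    have h2 := ((condExp_lin_s13 hx hS hwS hS').symm.trans h1).trans (condExp_lin_s13 hx hT hwT hT')
    have h3 : lin (stack N d x) (wS - wT) =ᵐ[μ] 0 := by
      rw [lin_sub]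
      filter_upwards [h2] with ω hω
      simp [hω]
    have h4 := gauss_var hX hx.2.1 hx.2.2.posSemidef (wS - wT)
    rw [variance_congr h3, variance_zero] at h4
    have h5 : wS - wT = 0 := by
      by_contra hne
      have := hx.2.2.dotProduct_mulVec_pos hne
      simp only [star_trivial] at this
      linarith
    refine ⟨wT, hwT, ?_⟩
    rw [sub_eq_zero] at h5
    rw [← h5]; exact hS'
  · intro h A hA
    choose w hw hw' using h
    let r : Ω → Fin d → ℝ := fun ω a => lin (stack N d x) (Pi.single (k, a) 1 - w a) ω
    have hr : Measurable r := measurable_pi_lambda _ fun a => measurable_lin hX _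
    have key : ∀ U : Set ℕ, U ⊆ Set.Iic N → (∀ a, Supp (w a) U) →
        (∀ a u, Supp u U → (Pi.single (k, a) 1 - w a) ⬝ᵥ C.mulVec u = 0) →
        μ[A.indicator (fun _ => (1 : ℝ)) ∘ x k | sigmaOf x U] =ᵐ[μ]
          fun ω => ∫ z, A.indicator (fun _ => (1 : ℝ))
            (z + fun a => lin (stack N d x) (w a) ω) ∂(μ.map r) := by
      intro U hU hwU hL
      have := condExp_shift (μ := μ) (measurable_subY hx U) hr (indep_resid hx _ hL)
        (hh := fun y a => evalS U (w a) y)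
        (measurable_pi_lambda _ fun a => measurable_evalS U (w a)) hA
      rw [sigmaOf_eq hU]
      simp only [evalS_subY (hwU _)] at this
      convert this using 2
      funext ω
      simp only [Function.comp]
      congr 1
      funext a
      simp only [r, Pi.add_apply, lin_sub, Pi.sub_apply, lin_single, sub_add_cancel]
      rfl
    exact (key S hS (fun a => (hw a).mono hTS) hw').trans
      (key T hT hw fun a u hu => hw' a u (hu.mono hTS)).symm

end CondIff

section LinAlg

variable {N d : ℕ}

/-- Blocks of the matrix `I - H`. -/
def Lb (H : ℕ → ℕ → Mat d) (k a : ℕ) : Mat d := (if k = a then 1 else 0) - H k a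

/-- The stacked matrix `I - H`. -/
def Lmat (N : ℕ) (H : ℕ → ℕ → Mat d) :
    Matrix (Fin (N + 1) × Fin d) (Fin (N + 1) × Fin d) ℝ :=
  fun p q => Lb H p.1 q.1 p.2 q.2

lemma blockDiag_mul (G G' : ℕ → Mat d) :
    blockDiag N d G * blockDiag N d G' = blockDiag N d (fun k => G k * G' k) := by
  ext p q
  simp only [blockDiag, Matrix.mul_apply, Fintype.sum_prod_type]
  rw [Finset.sum_eq_single p.1]
  · by_cases h : (p.1 : ℕ) = q.1 <;> simp [h]
  · intro b _ hb
    have : ¬ (p.1 : ℕ) = b := fun h => hb (Fin.ext h.symm)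
    simp [this]
  · simp

lemma blockDiag_one {G : ℕ → Mat d} (h : ∀ k, k ≤ N → G k = 1) : blockDiag N d G = 1 := by
  ext p q
  simp only [blockDiag, Matrix.one_apply]
  rw [h _ (Nat.lt_succ_iff.1 p.1.2), Matrix.one_apply]
  rcases p with ⟨p, i⟩
  rcases q with ⟨q, j⟩
  by_cases h : p = q
  · subst h; simp
  · have : ¬ (p : ℕ) = q := fun h' => h (Fin.ext h')
    simp [h, this]

lemma prec_entry (H : ℕ → ℕ → Mat d) (G : ℕ → Mat d) (p q : Fin (N + 1) × Fin d) :
    ((Lmat N H)ᵀ * blockDiag N d G * Lmat N H) p q =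
      (∑ k ∈ Finset.range (N + 1), (Lb H k p.1)ᵀ * G k * Lb H k q.1) p.2 q.2 := by
  have h1 : ∀ p r, ((Lmat N H)ᵀ * blockDiag N d G) p r = ((Lb H r.1 p.1)ᵀ * G r.1) p.2 r.2 := by
    intro p r
    simp only [blockDiag, Matrix.mul_apply, Fintype.sum_prod_type, Matrix.transpose_apply, Lmat]
    rw [Finset.sum_eq_single r.1]
    · simp
    · intro b _ hb
      have : ¬ (b : ℕ) = r.1 := fun h => hb (Fin.ext h)
      simp [this]
    · simp
  rw [Matrix.mul_apply, Fintype.sum_prod_type, Finset.sum_range, Matrix.sum_apply]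
  refine Finset.sum_congr rfl fun k _ => ?_
  simp only [h1]
  rw [Matrix.mul_apply]
  rfl

lemma prec_eq {C : Matrix (Fin (N + 1) × Fin d) (Fin (N + 1) × Fin d) ℝ}
    {H : ℕ → ℕ → Mat d} {G : ℕ → Mat d} (hG : ∀ k, k ≤ N → (G k).PosDef)
    (h : Lmat N H * C * (Lmat N H)ᵀ = blockDiag N d G) :
    C * ((Lmat N H)ᵀ * blockDiag N d (fun k => (G k)⁻¹) * Lmat N H) = 1 := by
  have hD : blockDiag N d G * blockDiag N d (fun k => (G k)⁻¹) = 1 := by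
    rw [blockDiag_mul]
    refine blockDiag_one fun k hk => ?_
    exact Matrix.mul_nonsing_inv _ ((Matrix.isUnit_iff_isUnit_det _).1 (hG k hk).isUnit)
  rw [← h] at hD
  have h2 : Lmat N H * (C * (Lmat N H)ᵀ * blockDiag N d (fun k => (G k)⁻¹)) = 1 := by
    rw [← hD]; simp only [Matrix.mul_assoc]
  rw [mul_eq_one_comm] at h2
  rw [← h2]; simp only [Matrix.mul_assoc]

variable {C : Matrix (Fin (N + 1) × Fin d) (Fin (N + 1) × Fin d) ℝ}

lemma LinEq.of_supp {v : Fin (N + 1) × Fin d → ℝ} {S T : Set ℕ} (h : Supp v T) :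
    LinEq C v S T := ⟨v, h, fun u _ => by simp⟩

lemma LinEq.of_perp {v : Fin (N + 1) × Fin d → ℝ} {S T : Set ℕ}
    (h : ∀ u, Supp u S → v ⬝ᵥ C.mulVec u = 0) :
    LinEq C v S T := ⟨0, supp_zero, fun u hu => by simpa using h u hu⟩

lemma LinEq.add {v v' : Fin (N + 1) × Fin d → ℝ} {S T : Set ℕ} (h : LinEq C v S T)
    (h' : LinEq C v' S T) : LinEq C (v + v') S T := by
  obtain ⟨w, hw, h⟩ := h
  obtain ⟨w', hw', h'⟩ := h'
  refine ⟨w + w', hw.add hw', fun u hu => ?_⟩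
  rw [add_sub_add_comm, add_dotProduct, h u hu, h' u hu, add_zero]

lemma LinEq.smul {v : Fin (N + 1) × Fin d → ℝ} {S T : Set ℕ} (c : ℝ) (h : LinEq C v S T) :
    LinEq C (c • v) S T := by
  obtain ⟨w, hw, h⟩ := h
  refine ⟨c • w, hw.smul c, fun u hu => ?_⟩
  rw [← smul_sub, smul_dotProduct, h u hu, smul_zero]

lemma sum_single (v : Fin (N + 1) × Fin d → ℝ) :
    v = ∑ p, v p • (Pi.single p 1 : Fin (N + 1) × Fin d → ℝ) := by
  ext q
  simp [Finset.sum_apply, Pi.single_apply]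

lemma LinEq.ext_supp {v : Fin (N + 1) × Fin d → ℝ} {Q S T : Set ℕ} (hv : Supp v Q)
    (h : ∀ p : Fin (N + 1) × Fin d, (p.1 : ℕ) ∈ Q → LinEq C (Pi.single p 1) S T) :
    LinEq C v S T := by
  rw [sum_single v]
  refine Finset.sum_induction _ (fun v => LinEq C v S T) (fun _ _ h h' => h.add h')
    (LinEq.of_supp supp_zero) fun p _ => ?_
  by_cases hp : (p.1 : ℕ) ∈ Q
  · exact (h p hp).smul _
  · rw [hv p hp, zero_smul]; exact LinEq.of_supp supp_zero

lemma perp_supp {v u : Fin (N + 1) × Fin d → ℝ} {S : Set ℕ} (hu : Supp u S)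
    (h : ∀ q : Fin (N + 1) × Fin d, (q.1 : ℕ) ∈ S → v ⬝ᵥ C.mulVec (Pi.single q 1) = 0) :
    v ⬝ᵥ C.mulVec u = 0 := by
  rw [sum_single u]
  refine Finset.sum_induction _ (fun u => v ⬝ᵥ C.mulVec u = 0)
    (fun a b ha hb => by rw [mulVec_add, dotProduct_add, ha, hb, add_zero]) (by simp) fun p _ => ?_
  by_cases hp : (p.1 : ℕ) ∈ S
  · rw [mulVec_smul, dotProduct_smul, h p hp, smul_zero]
  · rw [hu p hp]; simp

lemma posDef_zero {n : Type*} [Fintype n] {M : Matrix n n ℝ} (hM : M.PosDef) {v : n → ℝ} (h : v ⬝ᵥ M.mulVec v = 0) : v = 0 := by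
  by_contra hv
  have := hM.dotProduct_mulVec_pos hv
  simp only [star_trivial] at this
  exact absurd h this.ne'

lemma sep_of_prec (hC : C.PosDef) {A : Matrix (Fin (N + 1) × Fin d) (Fin (N + 1) × Fin d) ℝ}
    (hA : C * A = 1) {j : ℕ} (hj : j < N)
    (h0 : ∀ p q : Fin (N + 1) × Fin d, (p.1 : ℕ) < j → j < (q.1 : ℕ) → (q.1 : ℕ) < N → A p q = 0)
    {v : Fin (N + 1) × Fin d → ℝ} (hv : Supp v {t | j < t ∧ t < N}) :
    LinEq C v (Set.Icc 0 j ∪ {N}) ({j} ∪ {N}) := by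
  classical
  obtain ⟨w, hw, hperp⟩ := linEq_self hC v ({j} ∪ {N})
  refine ⟨w, hw, fun y hy => ?_⟩
  have hAinv : A = C⁻¹ := (Matrix.inv_eq_right_inv hA).symm
  have hApos : A.PosDef := by rw [hAinv]; exact hC.inv
  have hA' : A * C = 1 := mul_eq_one_comm.1 hA
  set u := v - w with hu
  set z := C.mulVec u with hz
  have hz1 : ∀ y, y ⬝ᵥ z = u ⬝ᵥ C.mulVec y := fun y => bil_comm hC.posSemidef y u
  have hzp : ∀ p : Fin (N + 1) × Fin d, z p = u ⬝ᵥ C.mulVec (Pi.single p 1) := by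
    intro p; rw [← hz1]; simp
  have hzR : ∀ p : Fin (N + 1) × Fin d, (p.1 : ℕ) ∈ ({j} ∪ {N} : Set ℕ) → z p = 0 := fun p hp => by
    rw [hzp]; exact hperp _ (supp_single p hp 1)
  have hAz : A.mulVec z = u := by rw [hz, mulVec_mulVec, hA', one_mulVec]
  let zP : Fin (N + 1) × Fin d → ℝ := fun p => if (p.1 : ℕ) < j then z p else 0
  have e1 : zP ⬝ᵥ A.mulVec z = 0 := by
    rw [hAz]
    refine Finset.sum_eq_zero fun p _ => ?_
    by_cases hp : (p.1 : ℕ) < j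
    · have h1 : v p = 0 := hv p (by simp; omega)
      have h2 : w p = 0 := hw p (by simp; omega)
      simp [hu, h1, h2]
    · simp [zP, hp]
  have e2 : zP ⬝ᵥ A.mulVec (z - zP) = 0 := by
    refine Finset.sum_eq_zero fun p _ => ?_
    by_cases hp : (p.1 : ℕ) < j
    · have : A.mulVec (z - zP) p = 0 := by
        refine Finset.sum_eq_zero fun q _ => ?_
        by_cases hq : (q.1 : ℕ) < j
        · simp [zP, hq]
        · by_cases hq' : (q.1 : ℕ) ∈ ({j} ∪ {N} : Set ℕ)
          · simp [zP, hq, hzR q hq']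
          · have := q.1.2
            simp at hq'
            have h5 := h0 p q hp (by omega) (by omega)
            simp only [h5, zero_mul]
      rw [this, mul_zero]
    · simp [zP, hp]
  have e3 : zP = 0 := by
    apply posDef_zero hApos
    rw [mulVec_sub, dotProduct_sub, e1] at e2
    linarith
  rw [← hz1]
  refine Finset.sum_eq_zero fun p _ => ?_
  by_cases hp : (p.1 : ℕ) ∈ (Set.Icc 0 j ∪ {N} : Set ℕ)
  · have : z p = 0 := by
      by_cases hp' : (p.1 : ℕ) < j
      · have := congrFun e3 p
        simpa [zP, hp'] using this
      · apply hzR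
        simp at hp ⊢
        omega
    rw [this, mul_zero]
  · rw [hy p hp, zero_mul]

lemma prec_of_sep (hC : C.PosDef) {A : Matrix (Fin (N + 1) × Fin d) (Fin (N + 1) × Fin d) ℝ}
    (hA : C * A = 1) {j : ℕ}
    (h : ∀ p : Fin (N + 1) × Fin d, j < (p.1 : ℕ) → (p.1 : ℕ) < N →
      LinEq C (Pi.single p 1) (Set.Icc 0 j ∪ {N}) ({j} ∪ {N}))
    (p q : Fin (N + 1) × Fin d) (hp : (p.1 : ℕ) < j) (hq : j < (q.1 : ℕ)) (hqN : (q.1 : ℕ) < N) :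
    A p q = 0 := by
  classical
  set u := A.mulVec (Pi.single q 1) with hu
  have hCu : C.mulVec u = Pi.single q 1 := by rw [hu, mulVec_mulVec, hA, one_mulVec]
  let uQ : Fin (N + 1) × Fin d → ℝ := fun p => if j < (p.1 : ℕ) ∧ (p.1 : ℕ) < N then u p else 0
  have huQ : Supp uQ {t | j < t ∧ t < N} := fun p hp => by
    simp only [Set.mem_setOf_eq] at hp
    simp [uQ, hp]
  obtain ⟨w, hw, hperp⟩ := LinEq.ext_supp (C := C) huQ fun p hp => h p hp.1 hp.2
  set y := u - (uQ - w) with hy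
  have hyS : Supp y (Set.Icc 0 j ∪ {N}) := by
    intro r hr
    have := r.1.2
    simp at hr
    have h1 : j < (r.1 : ℕ) ∧ (r.1 : ℕ) < N := by omega
    have h2 : w r = 0 := hw r (by simp; omega)
    simp [hy, uQ, h1, h2]
  have e1 : u ⬝ᵥ C.mulVec y = 0 := by
    rw [bil_comm hC.posSemidef, hCu]
    simp only [dotProduct_single, mul_one]
    exact hyS q (by simp; omega)
  have e2 : y = 0 := by
    apply posDef_zero hC
    conv_lhs => rw [hy]
    rw [sub_dotProduct, ← hy, e1, hperp y hyS, sub_zero]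
  have e3 := congrFun e2 p
  have h1 : ¬ (j < (p.1 : ℕ) ∧ (p.1 : ℕ) < N) := by omega
  have h2 : w p = 0 := hw p (by simp; omega)
  simp only [hy, Pi.sub_apply, uQ, h1, h2, if_false, Pi.zero_apply] at e3
  have : u p = A p q := by rw [hu]; simp
  linarith

end LinAlg

section Struct

variable {N d : ℕ} {k₂ : ℕ}

/-- Allowed predecessors in the model. -/
def Tp (N k₂ k t : ℕ) : Prop :=
  (k < k₂ ∧ (t + 1 = k ∨ t = k₂)) ∨ (k = N ∧ t ≤ k₂) ∨ (k₂ < k ∧ k < N ∧ (t + 1 = k ∨ t = N))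

/-- Order in which the states are generated by the model. -/
def rho (N k₂ k : ℕ) : ℕ := if k = k₂ then 0 else if k = N then k₂ + 1 else k + 1

lemma rho_lt (hk : k₂ < N) {k t : ℕ} (h : Tp N k₂ k t) : rho N k₂ t < rho N k₂ k := by
  unfold Tp at h; unfold rho; split_ifs <;> omega

lemma rho_inj (hk : k₂ < N) {k t : ℕ} (h1 : k ≤ N) (h2 : t ≤ N) (h : rho N k₂ t = rho N k₂ k) :
    t = k := by
  unfold rho at h; split_ifs at h <;> omega

/-- Row `p` of `I - H`. -/
def rowL (N : ℕ) (H : ℕ → ℕ → Mat d) (p : Fin (N + 1) × Fin d) : Fin (N + 1) × Fin d → ℝ :=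
  fun q => Lmat N H p q

/-- Row `p` of `H`. -/
def rowH (N : ℕ) (H : ℕ → ℕ → Mat d) (p : Fin (N + 1) × Fin d) : Fin (N + 1) × Fin d → ℝ :=
  fun q => H p.1 q.1 p.2 q.2

lemma row_split (H : ℕ → ℕ → Mat d) (p : Fin (N + 1) × Fin d) :
    (Pi.single p 1 : Fin (N + 1) × Fin d → ℝ) = rowL N H p + rowH N H p := by
  ext q
  rcases p with ⟨p, i⟩
  rcases q with ⟨q, j⟩
  simp only [Pi.single_apply, Pi.add_apply, rowL, rowH, Lmat, Lb, Matrix.sub_apply]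
  by_cases h : p = q
  · subst h
    by_cases h' : i = j
    · subst h'; simp
    · have : ¬ j = i := fun h => h' h.symm
      simp [h', this]
  · have h1 : ¬ q = p := fun h' => h h'.symm
    have h2 : ¬ (p : ℕ) = q := fun h' => h (Fin.ext h')
    simp [h1, h2]

lemma supp_rowH {H : ℕ → ℕ → Mat d} (hH : ∀ k t, ¬ Tp N k₂ k t → H k t = 0)
    (p : Fin (N + 1) × Fin d) : Supp (rowH N H p) {t | Tp N k₂ p.1 t} := by
  intro q hq
  simp [rowH, hH _ _ hq]

variable {C : Matrix (Fin (N + 1) × Fin d) (Fin (N + 1) × Fin d) ℝ}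

lemma LCL_apply (H : ℕ → ℕ → Mat d) (p q : Fin (N + 1) × Fin d) :
    (Lmat N H * C * (Lmat N H)ᵀ) p q = rowL N H p ⬝ᵥ C.mulVec (rowL N H q) := by
  rw [Matrix.mul_assoc, Matrix.mul_apply']
  rfl

lemma Lmat_injective (hk : k₂ < N) {H : ℕ → ℕ → Mat d}
    (hH : ∀ k t, ¬ Tp N k₂ k t → H k t = 0) : Function.Injective (Lmat N H).vecMul := by
  have key : ∀ v : Fin (N + 1) × Fin d → ℝ, v ᵥ* Lmat N H = 0 → v = 0 := by
    intro v hv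
    by_contra hne
    obtain ⟨p0, hp0⟩ := Function.ne_iff.1 hne
    obtain ⟨p, hp, hmax⟩ := Finset.exists_max_image (Finset.univ.filter fun p => v p ≠ 0)
      (fun p => rho N k₂ p.1) ⟨p0, by simpa using hp0⟩
    simp only [Finset.mem_filter, Finset.mem_univ, true_and] at hp hmax
    apply hp
    have h1 := congrFun hv p
    rw [Matrix.vecMul, dotProduct, Finset.sum_eq_single p] at h1
    · have : ¬ Tp N k₂ p.1 p.1 := fun h => absurd (rho_lt hk h) (lt_irrefl _)
      simpa [Lmat, Lb, hH _ _ this] using h1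
    · intro q _ hq
      by_cases hvq : v q = 0
      · simp [hvq]
      · have h2 := hmax q hvq
        have : ¬ Tp N k₂ q.1 p.1 := fun h => absurd (rho_lt hk h) (not_lt.2 h2)
        have h3 : Lmat N H q p = 0 := by
          simp only [Lmat, Lb, hH _ _ this, sub_zero]
          rcases q with ⟨q, i⟩
          rcases p with ⟨p, j⟩
          by_cases h : (q : ℕ) = p
          · have h' : q = p := Fin.ext h
            subst h'
            have : ¬ i = j := fun h => hq (by rw [h])
            simp [this]
          · simp [h]
        simp [h3]
    · simp
  intro v w hvw
  have := key (v - w) (by simpa [Matrix.sub_vecMul, sub_eq_zero] using hvw)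
  exact sub_eq_zero.1 this

lemma LCL_posDef (hC : C.PosDef) (hk : k₂ < N) {H : ℕ → ℕ → Mat d}
    (hH : ∀ k t, ¬ Tp N k₂ k t → H k t = 0) : (Lmat N H * C * (Lmat N H)ᵀ).PosDef := by
  have := hC.mul_mul_conjTranspose_same (Lmat_injective hk hH)
  rwa [Matrix.conjTranspose_eq_transpose_of_trivial] at this

lemma row_perp (hk : k₂ < N) {H : ℕ → ℕ → Mat d} {G : ℕ → Mat d}
    (hH : ∀ k t, ¬ Tp N k₂ k t → H k t = 0)
    (hD : Lmat N H * C * (Lmat N H)ᵀ = blockDiag N d G) (n : ℕ) :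
    ∀ p q : Fin (N + 1) × Fin d, rho N k₂ q.1 < n → rho N k₂ q.1 < rho N k₂ p.1 →
      rowL N H p ⬝ᵥ C.mulVec (Pi.single q 1) = 0 := by
  induction n with
  | zero => intro p q h; omega
  | succ n ih =>
    intro p q hn hpq
    rw [row_split H q, mulVec_add, dotProduct_add, ← LCL_apply, hD]
    have h1 : ¬ (p.1 : ℕ) = q.1 := fun h => by rw [h] at hpq; omega
    rw [perp_supp (supp_rowH hH q)]
    · simp [blockDiag, h1]
    · intro r hr
      have := rho_lt hk hr
      exact ih p r (by omega) (by omega)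

lemma chain (hk : k₂ < N) {H : ℕ → ℕ → Mat d} {G : ℕ → Mat d}
    (hH : ∀ k t, ¬ Tp N k₂ k t → H k t = 0)
    (hD : Lmat N H * C * (Lmat N H)ᵀ = blockDiag N d G) (j : ℕ) (n : ℕ) :
    ∀ p : Fin (N + 1) × Fin d, (p.1 : ℕ) < n → j < (p.1 : ℕ) → (p.1 : ℕ) ≤ k₂ →
      LinEq C (Pi.single p 1) (Set.Icc 0 j ∪ {k₂}) ({j} ∪ {k₂}) := by
  induction n with
  | zero => intro p h; omega
  | succ n ih =>
    intro p hpn hj hp2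
    rcases hp2.eq_or_lt with h | h
    · exact LinEq.of_supp (supp_single p (by simp [h]) 1)
    rw [row_split H p]
    apply LinEq.add
    · refine LinEq.of_perp fun u hu => perp_supp hu fun q hq => ?_
      refine row_perp hk hH hD (rho N k₂ q.1 + 1) p q (by omega) ?_
      simp at hq
      unfold rho; split_ifs <;> omega
    · refine LinEq.ext_supp (supp_rowH hH p) fun q hq => ?_
      simp only [Set.mem_setOf_eq, Tp] at hq
      by_cases hq' : (q.1 : ℕ) ∈ ({j} ∪ {k₂} : Set ℕ)
      · exact LinEq.of_supp (supp_single q hq' 1)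
      · simp at hq'
        exact ih q (by omega) (by omega) (by omega)

lemma block_sum_zero (hk : k₂ < N) {H : ℕ → ℕ → Mat d} (G : ℕ → Mat d)
    (hH : ∀ k t, ¬ Tp N k₂ k t → H k t = 0) {a b : ℕ} (hab : a + 2 ≤ b) (hb : k₂ < b)
    (hbN : b < N) :
    ∑ k ∈ Finset.range (N + 1), (Lb H k a)ᵀ * G k * Lb H k b = 0 := by
  refine Finset.sum_eq_zero fun k _ => ?_
  by_cases h : k = b ∨ k = b + 1
  · by_cases h' : k = a ∨ Tp N k₂ k a
    · by_cases h5 : b + 1 = k ∧ k = N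
      · have h1 : k ≠ b := by omega
        have h2 : ¬ Tp N k₂ k b := by unfold Tp; omega
        simp [Lb, h1, hH _ _ h2]
      · exfalso; unfold Tp at h'; omega
    · push Not at h'
      simp [Lb, h'.1, hH _ _ h'.2]
  · have h1 : k ≠ b := by omega
    have h2 : ¬ Tp N k₂ k b := by unfold Tp; omega
    simp [Lb, h1, hH _ _ h2]

lemma block_sum_lt (hk : k₂ < N) {H : ℕ → ℕ → Mat d} (G : ℕ → Mat d)
    (hH : ∀ k t, ¬ Tp N k₂ k t → H k t = 0) {a b : ℕ} (hab : a + 2 ≤ b) (hb : b < k₂) :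
    ∑ k ∈ Finset.range (N + 1), (Lb H k a)ᵀ * G k * Lb H k b = (H N a)ᵀ * G N * H N b := by
  rw [Finset.sum_eq_single N]
  · have h1 : N ≠ a := by omega
    have h2 : N ≠ b := by omega
    simp [Lb, h1, h2]
  · intro k hkN hk'
    by_cases h : k = b ∨ k = b + 1
    · have h1 : k ≠ a := by omega
      by_cases h5 : k = k₂
      · have h1 : k ≠ b := by omega
        have h2 : ¬ Tp N k₂ k b := by unfold Tp; omega
        simp [Lb, h1, hH _ _ h2]
      have h2 : ¬ Tp N k₂ k a := by unfold Tp; omega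
      simp [Lb, h1, hH _ _ h2]
    · have h1 : k ≠ b := by omega
      have h2 : ¬ Tp N k₂ k b := by simp at hkN; unfold Tp; omega
      simp [Lb, h1, hH _ _ h2]
  · simp

lemma block_sum_eq (hk : k₂ < N) {H : ℕ → ℕ → Mat d} (G : ℕ → Mat d)
    (hH : ∀ k t, ¬ Tp N k₂ k t → H k t = 0) {a : ℕ} (hab : a + 2 ≤ k₂) :
    ∑ k ∈ Finset.range (N + 1), (Lb H k a)ᵀ * G k * Lb H k k₂ =
      - (G a * H a k₂) + (H (a + 1) a)ᵀ * G (a + 1) * H (a + 1) k₂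
        + (H N a)ᵀ * G N * H N k₂ := by
  have hs : ({a, a + 1, N} : Finset ℕ) ⊆ Finset.range (N + 1) := by
    intro t; simp; omega
  rw [← Finset.sum_subset hs]
  · rw [Finset.sum_insert (by simp; omega), Finset.sum_insert (by simp; omega),
      Finset.sum_singleton]
    have h1 : ¬ a = k₂ := by omega
    have h2 : ¬ a + 1 = k₂ := by omega
    have h3 : ¬ N = k₂ := by omega
    have h4 : ¬ N = a := by omega
    have h5 : ¬ Tp N k₂ a a := by unfold Tp; omega
    simp only [Lb, h1, h2, h3, h4, hH _ _ h5, if_true, if_false, sub_zero, zero_sub,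
      Matrix.transpose_one, Matrix.one_mul, Matrix.mul_neg, Matrix.neg_mul, Matrix.transpose_neg,
      neg_neg, Nat.succ_ne_self]
    rw [add_assoc]
  · intro k hk1 hk2
    simp at hk1 hk2
    have h1 : k ≠ a := by omega
    have h2 : ¬ Tp N k₂ k a := by unfold Tp; omega
    simp [Lb, h1, hH _ _ h2]

/-- The intermediate algebraic form of the model. -/
def ModelM (N d k₂ : ℕ) (C : Matrix (Fin (N + 1) × Fin d) (Fin (N + 1) × Fin d) ℝ)
    (H : ℕ → ℕ → Mat d) (G : ℕ → Mat d) : Prop :=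
  (∀ k t, ¬ Tp N k₂ k t → H k t = 0) ∧
  Lmat N H * C * (Lmat N H)ᵀ = blockDiag N d G ∧
  (∀ k, k ≤ N → (G k).PosDef) ∧
  (∀ a b, a + 2 ≤ b → b ≤ k₂ →
    ∑ k ∈ Finset.range (N + 1), (Lb H k a)ᵀ * (G k)⁻¹ * Lb H k b = 0)

/-- Linear form of the conditionally Markov property. -/
def LinCM (N d : ℕ) (C : Matrix (Fin (N + 1) × Fin d) (Fin (N + 1) × Fin d) ℝ) (c : ℕ) : Prop :=
  ∀ j, ∀ p : Fin (N + 1) × Fin d, j < (p.1 : ℕ) → (p.1 : ℕ) ≤ c →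
    LinEq C (Pi.single p 1) (Set.Icc 0 j ∪ {c}) ({j} ∪ {c})

lemma cm_of_model (hC : C.PosDef) (hk : k₂ < N) {H : ℕ → ℕ → Mat d} {G : ℕ → Mat d}
    (h : ModelM N d k₂ C H G) : LinCM N d C N ∧ LinCM N d C k₂ := by
  obtain ⟨hH, hD, hG, hs⟩ := h
  refine ⟨fun j p hj hp => ?_, fun j p hj hp => chain hk hH hD j (p.1 + 1) p (by omega) hj hp⟩
  rcases hp.eq_or_lt with hpN | hpN
  · exact LinEq.of_supp (supp_single p (by simp [hpN]) 1)
  refine sep_of_prec hC (prec_eq hG hD) (by omega) ?_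
    (supp_single p (by simp; omega) 1)
  intro a b ha hb hbN
  rw [prec_entry]
  by_cases hb2 : (b.1 : ℕ) ≤ k₂
  · rw [hs _ _ (by omega) hb2]; rfl
  · rw [block_sum_zero hk _ hH (by omega) (by omega) hbN]; rfl

lemma exists_row (hC : C.PosDef) (hk : k₂ < N)
    (h1 : LinCM N d C N) (h2 : LinCM N d C k₂) (p : Fin (N + 1) × Fin d) :
    LinEq C (Pi.single p 1) {t | t ≤ N ∧ rho N k₂ t < rho N k₂ p.1} {t | Tp N k₂ p.1 t} := by
  have mono : ∀ {S S' T T' : Set ℕ}, LinEq C (Pi.single p 1) S' T' → S ⊆ S' → T' ⊆ T →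
      LinEq C (Pi.single p 1) S T := by
    rintro S S' T T' ⟨w, hw, h⟩ hS hT
    exact ⟨w, hw.mono hT, fun u hu => h u (hu.mono hS)⟩
  have hpN := p.1.2
  rcases lt_trichotomy (p.1 : ℕ) k₂ with hlt | heq | hgt
  · by_cases h0 : (p.1 : ℕ) = 0
    · refine mono (linEq_self hC _ {k₂}) ?_ ?_
      · rintro t ⟨ht, ht'⟩
        simp only [Set.mem_singleton_iff]
        unfold rho at ht'; split_ifs at ht' <;> omega
      · rintro t rfl
        exact Or.inl ⟨hlt, Or.inr rfl⟩
    · refine mono (h2 (p.1 - 1) p (by omega) (by omega)) ?_ ?_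
      · rintro t ⟨ht, ht'⟩
        simp
        unfold rho at ht'; split_ifs at ht' <;> omega
      · intro t ht
        simp at ht
        simp only [Set.mem_setOf_eq, Tp]
        omega
  · refine mono (linEq_self hC _ ∅) ?_ (Set.empty_subset _)
    rintro t ⟨ht, ht'⟩
    simp [rho, heq] at ht'
  · by_cases hN : (p.1 : ℕ) = N
    · refine mono (linEq_self hC _ (Set.Iic k₂)) ?_ ?_
      · rintro t ⟨ht, ht'⟩
        simp
        unfold rho at ht'; split_ifs at ht' <;> omega
      · intro t ht
        exact Or.inr (Or.inl ⟨hN, ht⟩)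
    · refine mono (h1 (p.1 - 1) p (by omega) (by omega)) ?_ ?_
      · rintro t ⟨ht, ht'⟩
        simp
        unfold rho at ht'; split_ifs at ht' <;> omega
      · intro t ht
        simp at ht
        simp only [Set.mem_setOf_eq, Tp]
        omega

lemma model_of_cm (hC : C.PosDef) (hk : k₂ < N)
    (h1 : LinCM N d C N) (h2 : LinCM N d C k₂) : ∃ H G, ModelM N d k₂ C H G := by
  choose W hWs hWp using exists_row hC hk h1 h2
  let H : ℕ → ℕ → Mat d := fun k t i j =>
    if h : k < N + 1 ∧ t < N + 1 then W (⟨k, h.1⟩, i) (⟨t, h.2⟩, j) else 0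
  have hWH : ∀ p, rowH N H p = W p := by
    intro p; ext q
    have h : (p.1 : ℕ) < N + 1 ∧ (q.1 : ℕ) < N + 1 := ⟨p.1.2, q.1.2⟩
    simp only [rowH, H]
    rw [dif_pos h]
  have hrow : ∀ p, rowL N H p = Pi.single p 1 - W p := by
    intro p
    rw [row_split H p, hWH]; simp
  have hH : ∀ k t, ¬ Tp N k₂ k t → H k t = 0 := by
    intro k t hkt
    ext i j
    simp only [H, Matrix.zero_apply]
    split_ifs with h
    · exact hWs _ _ hkt
    · rfl
  have horth : ∀ p q : Fin (N + 1) × Fin d, rho N k₂ q.1 < rho N k₂ p.1 →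
      rowL N H p ⬝ᵥ C.mulVec (rowL N H q) = 0 := by
    intro p q hpq
    rw [hrow p]
    apply hWp
    rw [hrow q]
    refine (supp_single q ?_ 1).sub ?_
    · exact ⟨Nat.lt_succ_iff.1 q.1.2, hpq⟩
    · intro r hr
      apply hWs
      intro h
      exact hr ⟨Nat.lt_succ_iff.1 r.1.2, (rho_lt hk h).trans hpq⟩
  have hpos := LCL_posDef hC hk hH
  let G : ℕ → Mat d := fun k i j =>
    if h : k < N + 1 then (Lmat N H * C * (Lmat N H)ᵀ) (⟨k, h⟩, i) (⟨k, h⟩, j) else 0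
  have hD : Lmat N H * C * (Lmat N H)ᵀ = blockDiag N d G := by
    ext p q
    by_cases hpq : (p.1 : ℕ) = q.1
    · have : p.1 = q.1 := Fin.ext hpq
      rcases p with ⟨p, i⟩
      rcases q with ⟨q, j⟩
      simp only at this
      subst this
      simp only [blockDiag, G, if_true]
      rw [dif_pos p.2]
    · rw [LCL_apply]
      simp only [blockDiag, hpq, if_false]
      rcases lt_trichotomy (rho N k₂ q.1) (rho N k₂ p.1) with h | h | h
      · exact horth p q h
      · exact absurd (rho_inj hk (Nat.lt_succ_iff.1 p.1.2) (Nat.lt_succ_iff.1 q.1.2) h).symm hpq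
      · rw [bil_comm hC.posSemidef]; exact horth q p h
  have hG : ∀ k, k ≤ N → (G k).PosDef := by
    intro k hkN
    have hk' : k < N + 1 := Nat.lt_succ_of_le hkN
    have hinj : Function.Injective (fun i : Fin d => ((⟨k, hk'⟩, i) : Fin (N + 1) × Fin d)) := by
      intro i j hij
      simpa using hij
    have := hpos.submatrix hinj
    convert this using 1
    ext i j
    simp only [G]
    rw [dif_pos hk']
    rfl
  refine ⟨H, G, hH, hD, hG, fun a b hab hb => ?_⟩
  ext i j
  have ha' : a < N + 1 := by omega
  have hb' : b < N + 1 := by omega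
  rw [← prec_entry H (fun k => (G k)⁻¹) ((⟨a, ha'⟩, i) : Fin (N + 1) × Fin d) (⟨b, hb'⟩, j)]
  refine prec_of_sep hC (prec_eq hG hD) (j := a + 1) (fun p hp hp' => h1 _ p hp hp'.le) _ _
    ?_ ?_ ?_
  · simp
  · simp; omega
  · simp; omega

end Struct

section Glue

variable {N d : ℕ} {k₂ : ℕ} {μ : Measure Ω}

lemma gauss_image {ι : Type*} [Fintype ι] {X X' : Ω → ι → ℝ} {C : Matrix ι ι ℝ}
    (L : Matrix ι ι ℝ) (h : IsZeroMeanGaussian μ X C) (hX' : ∀ᵐ ω ∂μ, X' ω = L.mulVec (X ω)) :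
    IsZeroMeanGaussian μ X' (L * C * Lᵀ) := by
  intro l
  have h1 : l ⬝ᵥ (L * C * Lᵀ).mulVec l = (l ᵥ* L) ⬝ᵥ C.mulVec (l ᵥ* L) := by
    rw [← mulVec_mulVec, ← mulVec_mulVec, mulVec_transpose, dotProduct_mulVec]
  rw [h1, ← h (l ᵥ* L)]
  refine Measure.map_congr ?_
  filter_upwards [hX'] with ω hω
  change l ⬝ᵥ X' ω = (l ᵥ* L) ⬝ᵥ X ω
  rw [hω, dotProduct_mulVec]

lemma Lmat_stack (H : ℕ → ℕ → Mat d) (x : ℕ → Ω → Fin d → ℝ) (ω : Ω)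
    (p : Fin (N + 1) × Fin d) :
    (Lmat N H).mulVec (stack N d x ω) p =
      (x p.1 ω - ∑ t ∈ Finset.range (N + 1), (H p.1 t).mulVec (x t ω)) p.2 := by
  have h0 : (Lmat N H).mulVec (stack N d x ω) p = rowL N H p ⬝ᵥ stack N d x ω := rfl
  have h1 : rowL N H p = Pi.single p 1 - rowH N H p := by
    rw [row_split H p]; simp
  rw [h0, h1, sub_dotProduct, single_one_dotProduct, Pi.sub_apply, Finset.sum_apply,
    Finset.sum_range, dotProduct, Fintype.sum_prod_type]
  rfl

lemma sum_H (hk : k₂ < N) {H : ℕ → ℕ → Mat d} (hH : ∀ k t, ¬ Tp N k₂ k t → H k t = 0)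
    (y : ℕ → Fin d → ℝ) :
    (∀ k, 1 ≤ k → k < k₂ → ∑ t ∈ Finset.range (N + 1), (H k t).mulVec (y t) =
      (H k (k - 1)).mulVec (y (k - 1)) + (H k k₂).mulVec (y k₂)) ∧
    (∑ t ∈ Finset.range (N + 1), (H k₂ t).mulVec (y t) = 0) ∧
    (1 ≤ k₂ → ∑ t ∈ Finset.range (N + 1), (H 0 t).mulVec (y t) = (H 0 k₂).mulVec (y k₂)) ∧
    (∑ t ∈ Finset.range (N + 1), (H N t).mulVec (y t) =
      ∑ t ∈ Finset.range (k₂ + 1), (H N t).mulVec (y t)) ∧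
    (∀ k, k₂ + 1 ≤ k → k ≤ N - 1 → ∑ t ∈ Finset.range (N + 1), (H k t).mulVec (y t) =
      (H k (k - 1)).mulVec (y (k - 1)) + (H k N).mulVec (y N)) := by
  refine ⟨fun k hk1 hk2 => ?_, ?_, fun hk1 => ?_, ?_, fun k hk1 hk2 => ?_⟩
  · have hs : ({k - 1, k₂} : Finset ℕ) ⊆ Finset.range (N + 1) := by intro t; simp; omega
    rw [← Finset.sum_subset hs, Finset.sum_pair (by omega)]
    intro t _ ht
    simp at ht
    rw [hH k t (by unfold Tp; omega), zero_mulVec]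
  · refine Finset.sum_eq_zero fun t _ => ?_
    rw [hH k₂ t (by unfold Tp; omega), zero_mulVec]
  · rw [Finset.sum_eq_single k₂]
    · intro t _ ht
      rw [hH 0 t (by unfold Tp; omega), zero_mulVec]
    · simp; omega
  · have hs : Finset.range (k₂ + 1) ⊆ Finset.range (N + 1) := by intro t; simp; omega
    rw [← Finset.sum_subset hs]
    intro t _ ht
    simp at ht
    rw [hH N t (by unfold Tp; omega), zero_mulVec]
  · have hs : ({k - 1, N} : Finset ℕ) ⊆ Finset.range (N + 1) := by intro t; simp; omega
    rw [← Finset.sum_subset hs, Finset.sum_pair (by omega)]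
    intro t _ ht
    simp at ht
    rw [hH k t (by unfold Tp; omega), zero_mulVec]

lemma isCM_iff [IsProbabilityMeasure μ] {x : ℕ → Ω → Fin d → ℝ}
    {C : Matrix (Fin (N + 1) × Fin d) (Fin (N + 1) × Fin d) ℝ}
    (hx : ZMNG N d μ x C) {c : ℕ} (hc : c ≤ N) : IsCM μ x 0 c c ↔ LinCM N d C c := by
  have hsub : ∀ j, ({j} ∪ {c} : Set ℕ) ⊆ Set.Icc 0 j ∪ {c} := by
    intro j t ht
    simp at ht ⊢
    omega
  have hS : ∀ j, j < c → (Set.Icc 0 j ∪ {c} : Set ℕ) ⊆ Set.Iic N := by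
    intro j hj t ht
    simp at ht ⊢
    omega
  constructor
  · intro h j p hj hp
    exact (condEq_iff_s13 hx p.1 (hsub j) (hS j (by omega))).1 (h j p.1 (Nat.zero_le _) hj hp) p.2
  · intro h j k _ hj hkc
    exact (condEq_iff_s13 hx ⟨k, by omega⟩ (hsub j) (hS j (by omega))).2
      fun a => h j (⟨k, by omega⟩, a) hj hkc

end Glue

/-- For `k₂ ∈ [1,N-1]`: a zero-mean nonsingular Gaussian sequence
`[x_k]`, `k ∈ [0,N]`, is both CM_L and `[0,k₂]`-CM_L iff it obeys the dynamic model
(33)-(36) with the parameter conditions (37)-(38) of the paper. Here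
`Gm k = G_{k,k-1}`, `Gk2 k = G_{k,k₂}` (`Gk2 0 = G_{0,k₂}`), `GNi i = G_{N,i}`,
`GN k = G_{k,N}`, and `Gcov k = G_k = Cov(e_k)`. -/
theorem stmt13 {N d : ℕ} (hN : 3 ≤ N) (hd : 1 ≤ d)
    (μ : Measure Ω) [IsProbabilityMeasure μ] (x : ℕ → Ω → Fin d → ℝ)
    (C : Matrix (Fin (N + 1) × Fin d) (Fin (N + 1) × Fin d) ℝ)
    (hx : ZMNG N d μ x C) (k₂ : ℕ) (hk₂1 : 1 ≤ k₂) (hk₂2 : k₂ ≤ N - 1) :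
    (IsCM μ x 0 N N ∧ IsCM μ x 0 k₂ k₂) ↔
      ∃ (Gm Gk2 GNi GN Gcov : ℕ → Mat d) (e : ℕ → Ω → Fin d → ℝ),
        ZMNG N d μ e (blockDiag N d Gcov) ∧
        (∀ k, k ≤ N → (Gcov k).PosDef) ∧
        (∀ᵐ ω ∂μ,
          (∀ k, 1 ≤ k → k < k₂ →
            x k ω = (Gm k).mulVec (x (k - 1) ω) + (Gk2 k).mulVec (x k₂ ω) + e k ω) ∧
          x k₂ ω = e k₂ ω ∧
          x 0 ω = (Gk2 0).mulVec (x k₂ ω) + e 0 ω ∧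
          x N ω = (∑ i ∈ Finset.range (k₂ + 1), (GNi i).mulVec (x i ω)) + e N ω ∧
          (∀ k, k₂ + 1 ≤ k → k ≤ N - 1 →
            x k ω = (Gm k).mulVec (x (k - 1) ω) + (GN k).mulVec (x N ω) + e k ω)) ∧
        (∀ j i, j + 3 ≤ k₂ → j + 2 ≤ i → i + 1 ≤ k₂ →
          (GNi j)ᵀ * (Gcov N)⁻¹ * GNi i = 0) ∧
        (∀ l, l + 2 ≤ k₂ →
          (Gcov l)⁻¹ * Gk2 l =
            (Gm (l + 1))ᵀ * (Gcov (l + 1))⁻¹ * Gk2 (l + 1) +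
            (GNi l)ᵀ * (Gcov N)⁻¹ * GNi k₂) := by
  have hk : k₂ < N := by omega
  have hC := hx.2.2
  rw [isCM_iff hx le_rfl, isCM_iff hx hk.le]
  constructor
  · rintro ⟨h1, h2⟩
    obtain ⟨H, G, hH, hD, hG, hs⟩ := model_of_cm hC hk h1 h2
    refine ⟨fun k => H k (k - 1), fun k => H k k₂, fun i => H N i, fun k => H k N, G,
      fun k ω => x k ω - ∑ t ∈ Finset.range (N + 1), (H k t).mulVec (x t ω), ⟨?_, ?_, ?_⟩, hG,
      ?_, ?_, ?_⟩
    · intro k hkN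
      refine (hx.1 k hkN).sub ?_
      refine Finset.measurable_fun_sum _ fun t ht => ?_
      have hm := hx.1 t (Nat.lt_succ_iff.1 (Finset.mem_range.1 ht))
      refine measurable_pi_lambda _ fun i => ?_
      simp only [mulVec, dotProduct]
      refine Finset.measurable_fun_sum _ fun j _ => ?_
      exact measurable_const.mul ((measurable_pi_apply j).comp hm)
    · rw [← hD]
      refine gauss_image _ hx.2.1 (Filter.Eventually.of_forall fun ω => ?_)
      ext p
      rw [Lmat_stack]
      rfl
    · rw [← hD]; exact LCL_posDef hC hk hH
    · refine Filter.Eventually.of_forall fun ω => ?_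
      obtain ⟨s1, s2, s3, s4, s5⟩ := sum_H hk hH (fun t => x t ω)
      refine ⟨fun k a b => ?_, ?_, ?_, ?_, fun k a b => ?_⟩
      · simp only [s1 k a b]; abel
      · simp only [s2]; abel
      · simp only [s3 hk₂1]; abel
      · simp only [s4]; abel
      · simp only [s5 k a b]; abel
    · intro j i hj hji hi
      have := hs j i hji (by omega)
      rwa [block_sum_lt hk (fun k => (G k)⁻¹) hH hji (by omega)] at this
    · intro l hl
      have := hs l k₂ hl le_rfl
      rw [block_sum_eq hk (fun k => (G k)⁻¹) hH hl, add_assoc, neg_add_eq_zero] at this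
      exact this
  · rintro ⟨Gm, Gk2, GNi, GN, G, e, he, hG, hae, h37, h38⟩
    let H : ℕ → ℕ → Mat d := fun k t =>
      if k < k₂ then (if t + 1 = k then Gm k else if t = k₂ then Gk2 k else 0)
      else if k = k₂ then 0
      else if k = N then (if t ≤ k₂ then GNi t else 0)
      else if k < N then (if t + 1 = k then Gm k else if t = N then GN k else 0)
      else 0
    have hH : ∀ k t, ¬ Tp N k₂ k t → H k t = 0 := by
      intro k t h
      unfold Tp at h
      simp only [H]
      split_ifs <;> first | rfl | (exfalso; omega)
    have H1 : ∀ k, 1 ≤ k → k ≠ k₂ → k < N → H k (k - 1) = Gm k := by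
      intro k a b c
      have : k - 1 + 1 = k := by omega
      simp only [H]
      split_ifs <;> first | rfl | (exfalso; omega)
    have H2 : ∀ k, k < k₂ → H k k₂ = Gk2 k := by
      intro k a
      simp only [H]
      split_ifs <;> first | rfl | (exfalso; omega)
    have H3 : ∀ t, t ≤ k₂ → H N t = GNi t := by
      intro t a
      simp only [H]
      split_ifs <;> first | rfl | (exfalso; omega)
    have H4 : ∀ k, k₂ < k → k < N → H k N = GN k := by
      intro k a b
      simp only [H]
      split_ifs <;> first | rfl | (exfalso; omega)
    have hst : ∀ᵐ ω ∂μ, stack N d e ω = (Lmat N H).mulVec (stack N d x ω) := by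
      filter_upwards [hae] with ω hω
      obtain ⟨r1, r2, r3, r4, r5⟩ := hω
      obtain ⟨s1, s2, s3, s4, s5⟩ := sum_H hk hH (fun t => x t ω)
      have key : ∀ k, k ≤ N →
          e k ω = x k ω - ∑ t ∈ Finset.range (N + 1), (H k t).mulVec (x t ω) := by
        intro k hkN
        rcases lt_trichotomy k k₂ with h | h | h
        · by_cases h0 : k = 0
          · subst h0
            rw [s3 hk₂1, H2 0 h]
            conv_rhs => rw [r3]
            abel
          · rw [s1 k (by omega) h, H1 k (by omega) (by omega) (by omega), H2 k h]
            conv_rhs => rw [r1 k (by omega) h]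
            abel
        · subst h
          rw [s2, sub_zero, r2]
        · by_cases h0 : k = N
          · subst h0
            rw [s4]
            have : ∑ t ∈ Finset.range (k₂ + 1), (H k t).mulVec (x t ω) =
                ∑ t ∈ Finset.range (k₂ + 1), (GNi t).mulVec (x t ω) :=
              Finset.sum_congr rfl fun t ht => by
                rw [H3 t (Nat.lt_succ_iff.1 (Finset.mem_range.1 ht))]
            rw [this]
            conv_rhs => rw [r4]
            abel
          · rw [s5 k (by omega) (by omega), H1 k (by omega) (by omega) (by omega),
              H4 k h (by omega)]
            conv_rhs => rw [r5 k (by omega) (by omega)]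
            abel
      ext p
      rw [Lmat_stack, ← key _ (Nat.lt_succ_iff.1 p.1.2)]
      rfl
    have hD : Lmat N H * C * (Lmat N H)ᵀ = blockDiag N d G :=
      cov_unique (LCL_posDef hC hk hH).posSemidef he.2.2.posSemidef
        (gauss_image _ hx.2.1 hst) he.2.1
    refine cm_of_model hC hk (H := H) (G := G) ⟨hH, hD, hG, fun a b hab hb => ?_⟩
    rcases hb.eq_or_lt with h | h
    · subst h
      rw [block_sum_eq hk (fun k => (G k)⁻¹) hH hab, add_assoc, neg_add_eq_zero]
      have := H1 (a + 1) (by omega) (by omega) (by omega)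
      rw [Nat.add_sub_cancel] at this
      rw [this, H2 a (by omega), H2 (a + 1) (by omega), H3 a (by omega), H3 b le_rfl]
      exact h38 a hab
    · rw [block_sum_lt hk (fun k => (G k)⁻¹) hH hab h, H3 a (by omega), H3 b (by omega)]
      exact h37 a b (by omega) hab (by omega)

end CMSeqPaper
end
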